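/- arXiv:2408.10456 — 2 statements merged into one kernel-verified Lean document; each statement's English description precedes it below -/
import Mathlib

section
/- Let D ∈ X^n be a dataset and let D′ be obtained from D either by removing one element or by adding one element, with batch size k ≤ min(|D|,|D′|), and set q = k/n. Then for every α > 1, sup over θ ∈ ℝ^p of the Rényi divergence D_α( p^{FSwoR}(·|θ,D) ‖ p^{FSwoR}(·|θ,D′) ) is at most D_α( q·N_{1,σ²/4} + (1−q)·N_{0,σ²/4} ‖ N_{0,σ²/4} ), where the right-hand side is the Rényi divergence of order α between the one-dimensional Gaussian mixture density q·N_{1,σ²/4} + (1−q)·N_{0,σ²/4} and the one-dimensional Gaussian density N_{0,σ²/4}. -/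
open MeasureTheory Finset

noncomputable section

/-- `p`-dimensional Gaussian density with mean `μ` and covariance `s² I`. -/
def gaussND {p : ℕ} (μ : EuclideanSpace ℝ (Fin p)) (s : ℝ)
    (x : EuclideanSpace ℝ (Fin p)) : ℝ :=
  (2 * Real.pi * s ^ 2) ^ (-(p : ℝ) / 2) * Real.exp (-‖x - μ‖ ^ 2 / (2 * s ^ 2))

/-- one-dimensional Gaussian density with mean `μ` and variance `s²`. -/
def gauss1 (μ s θ : ℝ) : ℝ :=
  (2 * Real.pi * s ^ 2) ^ (-(1 : ℝ) / 2) * Real.exp (-(θ - μ) ^ 2 / (2 * s ^ 2))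

/-- Rényi divergence of order `α` between densities `P` and `Q` w.r.t. the measure `ν`. -/
def renyiDiv {Ω : Type*} [MeasurableSpace Ω] (ν : Measure Ω) (α : ℝ) (P Q : Ω → ℝ) : ℝ :=
  (α - 1)⁻¹ * Real.log (∫ x, (P x / Q x) ^ α * Q x ∂ν)

/-- `M_{σ,k} = ∫ (N_{1,σ²/4}/N_{0,σ²/4} − 1)^k N_{0,σ²/4}`. -/
def Mcoef (σ : ℝ) (k : ℕ) : ℝ :=
  ∫ θ : ℝ, (gauss1 1 (σ / 2) θ / gauss1 0 (σ / 2) θ - 1) ^ k * gauss1 0 (σ / 2) θ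

/-- `B̃_{σ,j}`. -/
def Btil (σ : ℝ) (j : ℕ) : ℝ :=
  if Even j then Mcoef σ j else Real.sqrt (Mcoef σ (j - 1) * Mcoef σ (j + 1))

/-- `H_{α,σ}(q)`. -/
def Hfun (α σ q : ℝ) : ℝ :=
  ∫ θ : ℝ, (q * (gauss1 1 (σ / 2) θ / gauss1 0 (σ / 2) θ) + (1 - q)) ^ α * gauss1 0 (σ / 2) θ

/-- `R̃_{α,σ,3}(q)`. -/
def Rtil3 (α σ q : ℝ) : ℝ :=
  if 3 < α then
    q ^ 3 * α * (α - 1) * |α - 2| *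
      ((∑ ℓ ∈ Finset.range (⌈α⌉₊ - 3 + 1),
          q ^ ℓ * ((⌈α⌉₊ - 3).factorial : ℝ) /
            (((⌈α⌉₊ - 3 - ℓ).factorial : ℝ) * ((3 + ℓ).factorial : ℝ)) * Btil σ (ℓ + 3)) +
        1 / 6 * Btil σ 3)
  else
    q ^ 3 * α * (α - 1) * |α - 2| * (1 / 6 * (1 - q) ^ (α - 3) * Btil σ 3)

/-- `F̃_{α,σ,k}`. -/
def Ftil (α σ : ℝ) (k : ℕ) : ℝ :=
  (α - 1) * α ^ (k - 1) *
      (if Even k then 4 * Mcoef σ k else 3 * Real.sqrt (Mcoef σ (k - 1) * Mcoef σ (k + 1))) +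
    (α - 1) * α ^ (k - 1) *
      ∑ j ∈ Finset.range (k + 1),
        (k.choose j : ℝ) *
          |α / (α - 1) * (∏ ℓ ∈ Finset.range j, (1 - (ℓ : ℝ) / α)) *
              (∏ ℓ ∈ Finset.range (k - j), (1 + ((ℓ : ℝ) - 1) / α)) - 1| *
          Btil σ k

/-- `Ẽ_{α,σ,m}(q)`. -/
def Etil (α σ : ℝ) (m : ℕ) (q : ℝ) : ℝ :=
  (q ^ m / (m.factorial : ℝ)) *
    ∑ j ∈ Finset.range (m + 1),
      (1 - q) ^ (-(α + (m : ℝ) - (j : ℝ) - 1)) * (m.choose j : ℝ) *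
        (∏ ℓ ∈ Finset.range j, |α - (ℓ : ℝ)|) *
        (∏ ℓ ∈ Finset.range (m - j), (α + (ℓ : ℝ) - 1)) *
        (if α ≤ (j : ℝ) then (1 - q) ^ (α - (j : ℝ)) * Btil σ m
         else Btil σ m + ∑ ℓ ∈ Finset.range (⌈α⌉₊ - j + 1),
           q ^ ℓ * ((⌈α⌉₊ - j).factorial : ℝ) * (m.factorial : ℝ) /
             (((⌈α⌉₊ - j - ℓ).factorial : ℝ) * ((m + ℓ).factorial : ℝ)) * Btil σ (ℓ + m))

/-- clipping to norm at most `C`. -/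
def clip {E : Type*} [NormedAddCommGroup E] [NormedSpace ℝ E] (C : ℝ) (x : E) : E :=
  (max 1 (‖x‖ / C))⁻¹ • x

/-- DP-SGD one-step mean for an index batch `b`. -/
def muStep {X : Type*} {p n : ℕ} (C η : ℝ) (k : ℕ)
    (g : EuclideanSpace ℝ (Fin p) → X → EuclideanSpace ℝ (Fin p))
    (θ : EuclideanSpace ℝ (Fin p)) (b : Finset (Fin n)) (D : Fin n → X) :
    EuclideanSpace ℝ (Fin p) :=
  θ - (η / (k : ℝ)) • ∑ i ∈ b, clip C (g θ (D i))

/-- fixed-size without-replacement DP-SGD transition density. -/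
def pFSwoR {X : Type*} {p : ℕ} (C η σ : ℝ) (k : ℕ)
    (g : EuclideanSpace ℝ (Fin p) → X → EuclideanSpace ℝ (Fin p))
    (n : ℕ) (D : Fin n → X) (θ θ' : EuclideanSpace ℝ (Fin p)) : ℝ :=
  ((n.choose k : ℝ))⁻¹ *
    ∑ b ∈ Finset.powersetCard k (Finset.univ : Finset (Fin n)),
      gaussND (muStep C η k g θ b D) (C * η * σ / (k : ℝ)) θ'

/-- fixed-size with-replacement DP-SGD transition density. -/
def pFSwR {X : Type*} {p : ℕ} (C η σ : ℝ) (k : ℕ)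
    (g : EuclideanSpace ℝ (Fin p) → X → EuclideanSpace ℝ (Fin p))
    (n : ℕ) (D : Fin n → X) (θ θ' : EuclideanSpace ℝ (Fin p)) : ℝ :=
  (((n : ℝ)) ^ k)⁻¹ *
    ∑ b : Fin k → Fin n,
      gaussND (θ - (η / (k : ℝ)) • ∑ j : Fin k, clip C (g θ (D (b j))))
        (C * η * σ / (k : ℝ)) θ'

/-- Poisson-subsampled DP-SGD transition density with sampling probability `k/n`. -/
def pPoisson {X : Type*} {p : ℕ} (C η σ : ℝ) (k : ℕ)
    (g : EuclideanSpace ℝ (Fin p) → X → EuclideanSpace ℝ (Fin p))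
    (n : ℕ) (D : Fin n → X) (θ θ' : EuclideanSpace ℝ (Fin p)) : ℝ :=
  ∑ S : Finset (Fin n),
    ((k : ℝ) / n) ^ S.card * (1 - (k : ℝ) / n) ^ (n - S.card) *
      gaussND (muStep C η k g θ S D) (C * η * σ / (k : ℝ)) θ'

/-- removing the `i`-th entry of a tuple. -/
def removeIdx {X : Type*} {n : ℕ} (i : Fin (n + 1)) (D : Fin (n + 1) → X) : Fin n → X :=
  fun j => D (i.succAbove j)

/-- `D'` is obtained from `D` by removing one element. -/
def IsRemoveOne {X : Type*} {m n : ℕ} (D : Fin m → X) (D' : Fin n → X) : Prop :=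
  ∃ (h : n + 1 = m) (i : Fin (n + 1)), D' = removeIdx i (fun j => D (Fin.cast h j))

/-- add/remove adjacency. -/
def AdjAddRemove {X : Type*} {m n : ℕ} (D : Fin m → X) (D' : Fin n → X) : Prop :=
  IsRemoveOne D D' ∨ IsRemoveOne D' D

/-- replace-one adjacency: the datasets differ in exactly one coordinate. -/
def AdjReplaceOne {X : Type*} {n : ℕ} (D D' : Fin n → X) : Prop :=
  ∃ i : Fin n, D i ≠ D' i ∧ ∀ j : Fin n, j ≠ i → D j = D' j

/-- joint density of the `T`-step Markov chain (coordinates `Θ_1,…,Θ_T`),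
started at the deterministic point `θ₀`, with transition densities `ptrans t`. -/
def chainDensity {E : Type*} (T : ℕ) (ptrans : ℕ → E → E → ℝ) (θ₀ : E)
    (x : Fin T → E) : ℝ :=
  ∏ t : Fin T,
    ptrans t
      (if 0 < (t : ℕ) then
        x ⟨(t : ℕ) - 1, Nat.lt_of_le_of_lt (Nat.sub_le _ _) t.isLt⟩
      else θ₀)
      (x t)

open ProbabilityTheory

section GaussianDensity

variable {E : Type*} [NormedAddCommGroup E] [InnerProductSpace ℝ E] [FiniteDimensional ℝ E]
  [MeasurableSpace E] [BorelSpace E]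

/-- Isotropic Gaussian density on a finite-dimensional inner product space. -/
def isoGauss (μ : E) (s : ℝ) (x : E) : ℝ :=
  (2 * Real.pi * s ^ 2) ^ (-(Module.finrank ℝ E : ℝ) / 2) *
    Real.exp (-‖x - μ‖ ^ 2 / (2 * s ^ 2))

omit [FiniteDimensional ℝ E] [MeasurableSpace E] [BorelSpace E] in
lemma isoGauss_pos (μ : E) {s : ℝ} (hs : 0 < s) (x : E) : 0 < isoGauss μ s x := by
  unfold isoGauss
  have := Real.pi_pos
  positivity

omit [FiniteDimensional ℝ E] in
lemma measurable_isoGauss (μ : E) (s : ℝ) : Measurable (isoGauss μ s) := by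
  unfold isoGauss
  fun_prop

lemma integrable_isoGauss (μ : E) {s : ℝ} (hs : 0 < s) : Integrable (isoGauss μ s) := by
  have hb : 0 < ((1 / (2 * s ^ 2) : ℝ) : ℂ).re := by
    rw [Complex.ofReal_re]; positivity
  have h := (GaussianFourier.integrable_cexp_neg_mul_sq_norm_add hb 0 (0 : E)).norm.comp_sub_right μ
  refine (h.const_mul ((2 * Real.pi * s ^ 2) ^ (-(Module.finrank ℝ E : ℝ) / 2))).congr
    (Filter.Eventually.of_forall fun x => ?_)
  simp only [isoGauss, Complex.norm_exp]
  congr 2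
  rw [zero_mul, add_zero]
  norm_cast
  field_simp

lemma integral_isoGauss_mul_cexp (μ δ : E) {s : ℝ} (hs : 0 < s) (t : ℝ) :
    ∫ x, (isoGauss μ s x : ℂ) * Complex.exp (t * (inner ℝ δ (x - μ) / s ^ 2 : ℝ) * Complex.I) =
      Complex.exp (-(t ^ 2 * (‖δ‖ ^ 2 / s ^ 2) / 2 : ℝ)) := by
  have hb : 0 < ((1 / (2 * s ^ 2) : ℝ) : ℂ).re := by
    rw [Complex.ofReal_re]; positivity
  have hsC : (s : ℂ) ≠ 0 := by exact_mod_cast hs.ne'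
  have hp : (0 : ℝ) < 2 * Real.pi * s ^ 2 := by have := Real.pi_pos; positivity
  have h := GaussianFourier.integral_cexp_neg_mul_sq_norm_add hb (t * Complex.I / s ^ 2) δ
  rw [← integral_sub_right_eq_self _ μ] at h
  calc _ = ∫ x, (((2 * Real.pi * s ^ 2) ^ (-(Module.finrank ℝ E : ℝ) / 2) : ℝ) : ℂ) *
        Complex.exp (-((1 / (2 * s ^ 2) : ℝ) : ℂ) * ‖x - μ‖ ^ 2 +
          t * Complex.I / s ^ 2 * (inner ℝ δ (x - μ) : ℝ)) := by
        congr 1 with x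
        rw [isoGauss, Complex.ofReal_mul, mul_assoc, Complex.ofReal_exp, ← Complex.exp_add]
        congr 2
        push_cast
        field_simp
    _ = _ := by
        rw [integral_const_mul, h, ← mul_assoc]
        have h1 : ((Real.pi : ℂ) / ((1 / (2 * s ^ 2) : ℝ) : ℂ)) ^ ((Module.finrank ℝ E : ℂ) / 2)
            = (((2 * Real.pi * s ^ 2) ^ ((Module.finrank ℝ E : ℝ) / 2) : ℝ) : ℂ) := by
          rw [Complex.ofReal_cpow hp.le]
          push_cast
          congr 1
          field_simp
        rw [h1, ← Complex.ofReal_mul, ← Real.rpow_add hp, neg_div, neg_add_cancel, Real.rpow_zero,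
          Complex.ofReal_one, one_mul]
        congr 1
        push_cast
        field_simp
        rw [Complex.I_sq]
        ring

lemma map_withDensity_isoGauss (μ δ : E) {s : ℝ} (hs : 0 < s) :
    (volume.withDensity fun x => ENNReal.ofReal (isoGauss μ s x)).map
      (fun x => inner ℝ δ (x - μ) / s ^ 2) = gaussianReal 0 (‖δ‖ ^ 2 / s ^ 2).toNNReal := by
  have : IsFiniteMeasure (volume.withDensity fun x => ENNReal.ofReal (isoGauss μ s x)) :=
    isFiniteMeasure_withDensity_ofReal (integrable_isoGauss μ hs).2
  refine Measure.ext_of_charFun (funext fun t => ?_)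
  have hm := measurable_isoGauss μ s
  rw [charFun_gaussianReal, charFun_apply_real, integral_map (by fun_prop) (by fun_prop),
    integral_withDensity_eq_integral_toReal_smul (by fun_prop) (by simp)]
  rw [Real.coe_toNNReal _ (by positivity)]
  convert integral_isoGauss_mul_cexp μ δ hs t using 2 with x
  · ext x
    rw [ENNReal.toReal_ofReal (isoGauss_pos μ hs x).le, Complex.real_smul]
  · push_cast
    ring

omit [FiniteDimensional ℝ E] [MeasurableSpace E] [BorelSpace E] in
lemma isoGauss_div (μ₀ μ₁ : E) {s : ℝ} (hs : 0 < s) (x : E) :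
    isoGauss μ₁ s x / isoGauss μ₀ s x =
      Real.exp (inner ℝ (μ₁ - μ₀) (x - μ₀) / s ^ 2 - (‖μ₁ - μ₀‖ ^ 2 / s ^ 2).toNNReal / 2) := by
  have hp : (2 * Real.pi * s ^ 2) ^ (-(Module.finrank ℝ E : ℝ) / 2) ≠ 0 := by
    have := Real.pi_pos
    positivity
  rw [isoGauss, isoGauss, mul_div_mul_left _ _ hp, ← Real.exp_sub, Real.coe_toNNReal _ (by positivity)]
  congr 1
  have h : ‖x - μ₁‖ ^ 2 = ‖x - μ₀‖ ^ 2 - 2 * inner ℝ (μ₁ - μ₀) (x - μ₀) + ‖μ₁ - μ₀‖ ^ 2 := by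
    rw [show x - μ₁ = (x - μ₀) - (μ₁ - μ₀) by abel, norm_sub_sq_real, real_inner_comm]
  rw [h]
  field_simp
  ring

lemma integral_comp_isoGauss_div (μ₀ μ₁ : E) {s : ℝ} (hs : 0 < s) {f : ℝ → ℝ} (hf : Measurable f) :
    ∫ x, f (isoGauss μ₁ s x / isoGauss μ₀ s x) * isoGauss μ₀ s x =
      ∫ t, f (Real.exp (t - (‖μ₁ - μ₀‖ ^ 2 / s ^ 2).toNNReal / 2))
        ∂gaussianReal 0 (‖μ₁ - μ₀‖ ^ 2 / s ^ 2).toNNReal := by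
  have hm := measurable_isoGauss μ₀ s
  rw [← map_withDensity_isoGauss μ₀ _ hs,
    integral_map (by fun_prop) (Measurable.aestronglyMeasurable (by fun_prop)),
    integral_withDensity_eq_integral_toReal_smul (by fun_prop) (by simp)]
  congr 1 with x
  rw [ENNReal.toReal_ofReal (isoGauss_pos μ₀ hs x).le, isoGauss_div μ₀ μ₁ hs, smul_eq_mul, mul_comm]

lemma integrable_comp_isoGauss_div (μ₀ μ₁ : E) {s : ℝ} (hs : 0 < s) {f : ℝ → ℝ}
    (hf : Measurable f)
    (hi : Integrable (fun t => f (Real.exp (t - (‖μ₁ - μ₀‖ ^ 2 / s ^ 2).toNNReal / 2)))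
        (gaussianReal 0 (‖μ₁ - μ₀‖ ^ 2 / s ^ 2).toNNReal)) :
    Integrable (fun x => f (isoGauss μ₁ s x / isoGauss μ₀ s x) * isoGauss μ₀ s x) := by
  have hm := measurable_isoGauss μ₀ s
  rw [← map_withDensity_isoGauss μ₀ _ hs,
    integrable_map_measure (Measurable.aestronglyMeasurable (by fun_prop)) (by fun_prop),
    integrable_withDensity_iff_integrable_smul' (by fun_prop) (by simp)] at hi
  refine hi.congr (Filter.Eventually.of_forall fun x => ?_)
  simp only [Function.comp]
  rw [ENNReal.toReal_ofReal (isoGauss_pos μ₀ hs x).le, isoGauss_div μ₀ μ₁ hs, smul_eq_mul, mul_comm]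

end GaussianDensity

lemma gaussND_eq_isoGauss {p : ℕ} (μ : EuclideanSpace ℝ (Fin p)) (s : ℝ) :
    gaussND μ s = isoGauss μ s := by
  ext x
  simp [gaussND, isoGauss]

lemma gauss1_eq_isoGauss (μ s : ℝ) : gauss1 μ s = isoGauss μ s := by
  ext x
  simp [gauss1, isoGauss]

section Sinh

lemma sinh_mul_mul_sinh_le {c x y : ℝ} (hc : 1 ≤ c) (hy : 0 ≤ y) (hxy : y ≤ x) :
    Real.sinh (c * y) * Real.sinh x ≤ Real.sinh (c * x) * Real.sinh y := by
  rcases hy.eq_or_lt with rfl | hy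
  · simp
  have hnum : MonotoneOn
      (fun t => c * Real.cosh (c * t) * Real.sinh t - Real.sinh (c * t) * Real.cosh t)
      (Set.Ici 0) := by
    refine monotoneOn_of_hasDerivWithinAt_nonneg (convex_Ici 0) (by fun_prop)
      (f' := fun t => (c ^ 2 - 1) * (Real.sinh (c * t) * Real.sinh t))
      (fun t _ => HasDerivAt.hasDerivWithinAt ?_) (fun t ht => ?_)
    · have h1 : HasDerivAt (fun t : ℝ => c * t) c t := by simpa using (hasDerivAt_id t).const_mul c
      refine (((h1.cosh.const_mul c).mul (Real.hasDerivAt_sinh t)).sub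
        (h1.sinh.mul (Real.hasDerivAt_cosh t))).congr_deriv ?_
      ring
    · rw [interior_Ici] at ht
      have h2 : 0 ≤ Real.sinh t := Real.sinh_nonneg_iff.2 (le_of_lt ht)
      have h3 : 0 ≤ Real.sinh (c * t) :=
        Real.sinh_nonneg_iff.2 (mul_nonneg (by linarith) (le_of_lt ht))
      have h4 : 0 ≤ c ^ 2 - 1 := by nlinarith
      positivity
  have hquot : MonotoneOn (fun t => Real.sinh (c * t) / Real.sinh t) (Set.Ici y) := by
    have hne : ∀ t ∈ Set.Ici y, Real.sinh t ≠ 0 := fun t ht =>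
      (Real.sinh_pos_iff.2 (hy.trans_le ht)).ne'
    refine monotoneOn_of_hasDerivWithinAt_nonneg (convex_Ici y)
      (ContinuousOn.div (by fun_prop) (by fun_prop) hne)
      (f' := fun t => (c * Real.cosh (c * t) * Real.sinh t - Real.sinh (c * t) * Real.cosh t) /
        Real.sinh t ^ 2)
      (fun t ht => HasDerivAt.hasDerivWithinAt ?_) (fun t ht => ?_)
    · have h1 : HasDerivAt (fun t : ℝ => c * t) c t := by simpa using (hasDerivAt_id t).const_mul c
      refine (h1.sinh.div (Real.hasDerivAt_sinh t) (hne t (interior_subset ht))).congr_deriv ?_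
      ring
    · have ht' : 0 ≤ t := hy.le.trans (interior_subset ht)
      have := hnum (Set.self_mem_Ici) (show t ∈ Set.Ici (0 : ℝ) from ht') ht'
      simp only [mul_zero, Real.sinh_zero, Real.cosh_zero, zero_mul, sub_zero] at this
      positivity
  have h := hquot (Set.self_mem_Ici) (show x ∈ Set.Ici y from hxy) hxy
  rwa [div_le_div_iff₀ (Real.sinh_pos_iff.2 hy) (Real.sinh_pos_iff.2 (hy.trans_le hxy))] at h

lemma rpow_sub_rpow_one_sub {u : ℝ} (hu : 0 < u) (α : ℝ) :
    u ^ α - u ^ (1 - α) = 2 * (u ^ (1 / 2 : ℝ) * Real.sinh ((2 * α - 1) * (Real.log u / 2))) := by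
  have h1 : u ^ α = u ^ (1 / 2 : ℝ) * Real.exp ((2 * α - 1) * (Real.log u / 2)) := by
    rw [Real.rpow_def_of_pos hu, Real.rpow_def_of_pos hu, ← Real.exp_add]
    ring_nf
  have h2 : u ^ (1 - α) = u ^ (1 / 2 : ℝ) * Real.exp (-((2 * α - 1) * (Real.log u / 2))) := by
    rw [Real.rpow_def_of_pos hu, Real.rpow_def_of_pos hu, ← Real.exp_add]
    ring_nf
  rw [h1, h2, Real.sinh_eq]
  ring

lemma mix_rpow_symm_le_of_one_le {q z α : ℝ} (hq0 : 0 ≤ q) (hq1 : q ≤ 1) (hz : 1 ≤ z) (hα : 1 ≤ α) :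
    (q * z + (1 - q)) ^ (1 - α) + z * (q * z⁻¹ + (1 - q)) ^ (1 - α) ≤
      (q * z + (1 - q)) ^ α + z * (q * z⁻¹ + (1 - q)) ^ α := by
  have hz0 : 0 < z := by linarith
  have hzi : 0 < z⁻¹ := by positivity
  have hzi1 : z⁻¹ ≤ 1 := inv_le_one_of_one_le₀ hz
  have hzz : z * z⁻¹ = 1 := mul_inv_cancel₀ hz0.ne'
  set u := q * z + (1 - q) with hu
  set v := q * z⁻¹ + (1 - q) with hv
  have hu1 : 1 ≤ u := by nlinarith
  have hv1 : v ≤ 1 := by nlinarith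
  have hv0 : 0 < v := by nlinarith
  have huv : 1 ≤ u * v := by
    have : u * v = 1 + q * (1 - q) * ((z - 1) ^ 2 * z⁻¹) := by
      rw [hu, hv]; field_simp; ring
    rw [this]
    have : 0 ≤ q * (1 - q) := mul_nonneg hq0 (by linarith)
    have : 0 ≤ q * (1 - q) * ((z - 1) ^ 2 * z⁻¹) := by positivity
    linarith
  have hu0 : 0 < u := by linarith
  set x := Real.log u / 2 with hx
  set y := -Real.log v / 2 with hy
  have hy0 : 0 ≤ y := by
    have := Real.log_nonpos hv0.le hv1
    rw [hy]; linarith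
  have hxy : y ≤ x := by
    have := Real.log_nonneg huv
    rw [Real.log_mul hu0.ne' hv0.ne'] at this
    rw [hx, hy]; linarith
  have key : ∀ β : ℝ, u ^ β + z * v ^ β - (u ^ (1 - β) + z * v ^ (1 - β)) =
      2 * (u ^ (1 / 2 : ℝ) * Real.sinh ((2 * β - 1) * x)
        - z * v ^ (1 / 2 : ℝ) * Real.sinh ((2 * β - 1) * y)) := by
    intro β
    have h1 := rpow_sub_rpow_one_sub hu0 β
    have h2 := rpow_sub_rpow_one_sub hv0 β
    rw [show (2 * β - 1) * (Real.log v / 2) = -((2 * β - 1) * y) by rw [hy]; ring,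
      Real.sinh_neg] at h2
    linear_combination h1 + z * h2
  have h1 : u ^ (1 / 2 : ℝ) * Real.sinh x = z * v ^ (1 / 2 : ℝ) * Real.sinh y := by
    have := key 1
    norm_num at this
    have h0 : u + z * v - (1 + z) = 0 := by
      rw [hu, hv]; linear_combination q * hzz
    rw [h0] at this
    norm_num
    linarith
  have hgoal : z * v ^ (1 / 2 : ℝ) * Real.sinh ((2 * α - 1) * y) ≤
      u ^ (1 / 2 : ℝ) * Real.sinh ((2 * α - 1) * x) := by
    have hup : 0 < u ^ (1 / 2 : ℝ) := by positivity
    rcases hy0.eq_or_lt with h | h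
    · rw [← h, Real.sinh_zero, mul_zero] at h1
      have : Real.sinh x = 0 := by
        rcases mul_eq_zero.1 h1 with h' | h'
        · exact absurd h' hup.ne'
        · exact h'
      rw [Real.sinh_eq_zero.1 this, ← h]
      simp
    · have hs := Real.sinh_pos_iff.2 h
      have hle := sinh_mul_mul_sinh_le (show 1 ≤ 2 * α - 1 by linarith) hy0 hxy
      refine le_of_mul_le_mul_right ?_ hs
      calc _ = Real.sinh ((2 * α - 1) * y) * (z * v ^ (1 / 2 : ℝ) * Real.sinh y) := by ring
        _ = u ^ (1 / 2 : ℝ) * (Real.sinh ((2 * α - 1) * y) * Real.sinh x) := by rw [← h1]; ring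
        _ ≤ u ^ (1 / 2 : ℝ) * (Real.sinh ((2 * α - 1) * x) * Real.sinh y) := by gcongr
        _ = _ := by ring
  linarith [key α]

lemma mix_rpow_symm_le {q z α : ℝ} (hq0 : 0 ≤ q) (hq1 : q ≤ 1) (hz : 0 < z) (hα : 1 ≤ α) :
    (q * z + (1 - q)) ^ (1 - α) + z * (q * z⁻¹ + (1 - q)) ^ (1 - α) ≤
      (q * z + (1 - q)) ^ α + z * (q * z⁻¹ + (1 - q)) ^ α := by
  rcases le_total 1 z with h | h
  · exact mix_rpow_symm_le_of_one_le hq0 hq1 h hα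
  · have h' := mul_le_mul_of_nonneg_left
      (mix_rpow_symm_le_of_one_le hq0 hq1 ((one_le_inv₀ hz).2 h) hα) hz.le
    rw [inv_inv, mul_add, mul_add, mul_inv_cancel_left₀ hz.ne', mul_inv_cancel_left₀ hz.ne'] at h'
    linarith

end Sinh

section LogNormal

open scoped NNReal

lemma integrable_exp_sub_gaussianReal (v : ℝ≥0) (c : ℝ) :
    Integrable (fun t => Real.exp (t - c)) (gaussianReal 0 v) := by
  simp_rw [Real.exp_sub]
  simpa using (integrable_exp_mul_gaussianReal (μ := 0) (v := v) 1).div_const (Real.exp c)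

lemma integral_exp_sub_gaussianReal (v : ℝ≥0) (c : ℝ) :
    ∫ t, Real.exp (t - c) ∂gaussianReal 0 v = Real.exp (v / 2 - c) := by
  have h := congrFun (mgf_id_gaussianReal (μ := 0) (v := v)) 1
  simp only [mgf, id, one_mul, mul_one, zero_add, one_pow] at h
  simp_rw [Real.exp_sub]
  rw [integral_div, h]

lemma mix_rpow_le {q z α : ℝ} (hq0 : 0 ≤ q) (hq1 : q ≤ 1) (hz : 0 ≤ z) (hα : 1 ≤ α) :
    (q * z + (1 - q)) ^ α ≤ q * z ^ α + (1 - q) := by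
  have h := (convexOn_rpow hα).2 (show z ∈ Set.Ici 0 from hz)
    (show (1 : ℝ) ∈ Set.Ici 0 from zero_le_one' ℝ) hq0 (sub_nonneg.2 hq1) (by ring)
  simpa using h

lemma integrable_mix_rpow {q α : ℝ} (hq0 : 0 ≤ q) (hq1 : q ≤ 1) (hα : 1 ≤ α) (v : ℝ≥0) (c : ℝ) :
    Integrable (fun t => (q * Real.exp (t - c) + (1 - q)) ^ α) (gaussianReal 0 v) := by
  have hpos : ∀ t, 0 ≤ q * Real.exp (t - c) + (1 - q) := fun t =>
    add_nonneg (mul_nonneg hq0 (Real.exp_pos _).le) (sub_nonneg.2 hq1)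
  have hi : Integrable (fun t => q * (Real.exp (α * t) / Real.exp (α * c)) + (1 - q))
      (gaussianReal 0 v) :=
    (((integrable_exp_mul_gaussianReal α).div_const _).const_mul q).add (integrable_const _)
  refine hi.mono' (Measurable.aestronglyMeasurable (by fun_prop)) (Filter.Eventually.of_forall fun t => ?_)
  rw [Real.norm_of_nonneg (Real.rpow_nonneg (hpos t) _), ← Real.exp_sub, ← mul_sub, mul_comm α,
    Real.exp_mul]
  exact mix_rpow_le hq0 hq1 (Real.exp_pos _).le hα

lemma rpow_mean_mix_le {q α : ℝ} (hq0 : 0 ≤ q) (hq1 : q ≤ 1) (hα : 1 ≤ α) (v : ℝ≥0) (c : ℝ) :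
    (q * Real.exp (v / 2 - c) + (1 - q)) ^ α ≤
      ∫ t, (q * Real.exp (t - c) + (1 - q)) ^ α ∂gaussianReal 0 v := by
  have hi := integrable_exp_sub_gaussianReal v c
  have h := (convexOn_rpow hα).map_integral_le (μ := gaussianReal 0 v)
    (f := fun t => q * Real.exp (t - c) + (1 - q))
    (fun x _ => (Real.continuousAt_rpow_const x α (Or.inr (by linarith))).continuousWithinAt)
    isClosed_Ici
    (Filter.Eventually.of_forall fun t =>
      add_nonneg (mul_nonneg hq0 (Real.exp_pos _).le) (sub_nonneg.2 hq1))
    ((hi.const_mul q).add (integrable_const _)) (integrable_mix_rpow hq0 hq1 hα v c)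
  rwa [integral_add (hi.const_mul q) (integrable_const _), integral_const_mul,
    integral_exp_sub_gaussianReal, integral_const, probReal_univ, one_smul] at h

/-- The moment `E[(q Z + 1 - q) ^ α]` for a mean-one log-normal `Z` of log-variance `v`. -/
def mixMoment (α q : ℝ) (v : ℝ≥0) : ℝ :=
  ∫ t, (q * Real.exp (t - v / 2) + (1 - q)) ^ α ∂gaussianReal 0 v

lemma one_le_mixMoment {q α : ℝ} (hq0 : 0 ≤ q) (hq1 : q ≤ 1) (hα : 1 ≤ α) (v : ℝ≥0) :
    1 ≤ mixMoment α q v := by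
  simpa [mixMoment] using rpow_mean_mix_le hq0 hq1 hα v (v / 2)

lemma mixMoment_mono_var {q α : ℝ} (hq0 : 0 ≤ q) (hq1 : q ≤ 1) (hα : 1 ≤ α) {v w : ℝ≥0}
    (hvw : v ≤ w) : mixMoment α q v ≤ mixMoment α q w := by
  obtain ⟨r, rfl⟩ := exists_add_of_le hvw
  have hconv : gaussianReal 0 (v + r) = gaussianReal 0 v ∗ gaussianReal 0 r := by
    rw [gaussianReal_conv_gaussianReal, add_zero]
  have hi := integrable_mix_rpow hq0 hq1 hα (v + r) ((v + r : ℝ≥0) / 2)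
  have hpos : ∀ t c, 0 ≤ (q * Real.exp (t - c) + (1 - q)) ^ α := fun t c =>
    Real.rpow_nonneg (add_nonneg (mul_nonneg hq0 (Real.exp_pos _).le) (sub_nonneg.2 hq1)) _
  rw [hconv] at hi
  rw [mixMoment, mixMoment, hconv, integral_conv hi]
  have hi2 := ((integrable_conv_iff hi.aestronglyMeasurable).1 hi).2
  simp_rw [Real.norm_of_nonneg (hpos _ _)] at hi2
  refine integral_mono (integrable_mix_rpow hq0 hq1 hα v _) hi2 fun x => ?_
  have h := rpow_mean_mix_le hq0 hq1 hα r ((v + r : ℝ≥0) / 2 - x)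
  have h1 : (r : ℝ) / 2 - ((v + r : ℝ≥0) / 2 - x) = x - v / 2 := by push_cast; ring
  have h2 : ∀ y : ℝ, y - ((v + r : ℝ≥0) / 2 - x) = x + y - (v + r : ℝ≥0) / 2 := fun y => by ring
  simpa only [h1, h2] using h

lemma mixMoment_mono_weight {q q' α : ℝ} (hq0' : 0 ≤ q') (hqq : q' ≤ q) (hq1 : q ≤ 1) (hα : 1 ≤ α)
    (v : ℝ≥0) : mixMoment α q' v ≤ mixMoment α q v := by
  have hq0 := hq0'.trans hqq
  rcases hq0.eq_or_lt with rfl | hq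
  · rw [le_antisymm hqq hq0']
  have hl0 : 0 ≤ q' / q := by positivity
  have hl1 : q' / q ≤ 1 := (div_le_one hq).2 hqq
  have hi := integrable_mix_rpow hq0 hq1 hα v (v / 2)
  have h : mixMoment α q' v ≤ q' / q * mixMoment α q v + (1 - q' / q) := by
    have : q' / q * mixMoment α q v + (1 - q' / q) =
        ∫ t, q' / q * (q * Real.exp (t - v / 2) + (1 - q)) ^ α + (1 - q' / q)
          ∂gaussianReal 0 v := by
      rw [integral_add (hi.const_mul _) (integrable_const _), integral_const_mul]
      simp [mixMoment]
    rw [this]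
    refine integral_mono (integrable_mix_rpow hq0' (hqq.trans hq1) hα v _)
      ((hi.const_mul _).add (integrable_const _)) fun t => ?_
    have hle := mix_rpow_le hl0 hl1 (z := q * Real.exp (t - v / 2) + (1 - q))
      (add_nonneg (mul_nonneg hq0 (Real.exp_pos _).le) (sub_nonneg.2 hq1)) hα
    have heq : q' / q * (q * Real.exp (t - v / 2) + (1 - q)) + (1 - q' / q) =
        q' * Real.exp (t - v / 2) + (1 - q') := by
      field_simp
      ring
    rwa [heq] at hle
  nlinarith [one_le_mixMoment hq0 hq1 hα v]

lemma gaussianPDFReal_reflect {v : ℝ≥0} (hv : v ≠ 0) (x : ℝ) :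
    gaussianPDFReal 0 v (v - x) = gaussianPDFReal 0 v x * Real.exp (x - v / 2) := by
  have hv' : (v : ℝ) ≠ 0 := by exact_mod_cast hv
  rw [gaussianPDFReal, gaussianPDFReal, mul_assoc _ (Real.exp _), ← Real.exp_add]
  congr 2
  field_simp
  ring

lemma integrable_gaussianReal_iff {v : ℝ≥0} (hv : v ≠ 0) {f : ℝ → ℝ} :
    Integrable f (gaussianReal 0 v) ↔ Integrable fun x => gaussianPDFReal 0 v x * f x := by
  rw [gaussianReal_of_var_ne_zero 0 hv,
    integrable_withDensity_iff_integrable_smul' (measurable_gaussianPDF 0 v)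
      (Filter.Eventually.of_forall fun _ => gaussianPDF_lt_top)]
  simp [toReal_gaussianPDF]

lemma integrable_and_integral_exp_mul_comp_inv (v : ℝ≥0) {f : ℝ → ℝ}
    (hf : Integrable (fun t => f (Real.exp (t - v / 2))) (gaussianReal 0 v)) :
    Integrable (fun t => Real.exp (t - v / 2) * f (Real.exp (t - v / 2))⁻¹) (gaussianReal 0 v) ∧
      ∫ t, Real.exp (t - v / 2) * f (Real.exp (t - v / 2))⁻¹ ∂gaussianReal 0 v =
        ∫ t, f (Real.exp (t - v / 2)) ∂gaussianReal 0 v := by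
  rcases eq_or_ne v 0 with rfl | hv
  · simp [gaussianReal_zero_var, integrable_dirac]
  have heq : ∀ t : ℝ, gaussianPDFReal 0 v (v - t) * f (Real.exp (v - t - v / 2)) =
      gaussianPDFReal 0 v t * (Real.exp (t - v / 2) * f (Real.exp (t - v / 2))⁻¹) := by
    intro t
    rw [gaussianPDFReal_reflect hv, ← Real.exp_neg, mul_assoc]
    ring_nf
  rw [integrable_gaussianReal_iff hv] at hf ⊢
  have hs := hf.comp_sub_left (v : ℝ)
  simp_rw [heq] at hs
  refine ⟨hs, ?_⟩
  rw [integral_gaussianReal_eq_integral_smul hv, integral_gaussianReal_eq_integral_smul hv]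
  simp_rw [smul_eq_mul, ← heq]
  exact integral_sub_left_eq_self (fun t => gaussianPDFReal 0 v t * f (Real.exp (t - v / 2))) _ _

lemma integrable_mix_rpow_one_sub {q α : ℝ} (hq0 : 0 ≤ q) (hq1 : q < 1) (hα : 1 ≤ α)
    (v : ℝ≥0) (c : ℝ) :
    Integrable (fun t => (q * Real.exp (t - c) + (1 - q)) ^ (1 - α)) (gaussianReal 0 v) := by
  refine (integrable_const ((1 - q) ^ (1 - α))).mono'
    (Measurable.aestronglyMeasurable (by fun_prop)) (Filter.Eventually.of_forall fun t => ?_)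
  have h1 : 1 - q ≤ q * Real.exp (t - c) + (1 - q) :=
    le_add_of_nonneg_left (mul_nonneg hq0 (Real.exp_pos _).le)
  rw [Real.norm_of_nonneg (Real.rpow_nonneg ((sub_pos.2 hq1).le.trans h1) _)]
  exact Real.rpow_le_rpow_of_nonpos (sub_pos.2 hq1) h1 (by linarith)

lemma integral_mix_rpow_one_sub_le {q α : ℝ} (hq0 : 0 ≤ q) (hq1 : q < 1) (hα : 1 ≤ α) (v : ℝ≥0) :
    ∫ t, (q * Real.exp (t - v / 2) + (1 - q)) ^ (1 - α) ∂gaussianReal 0 v ≤ mixMoment α q v := by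
  have hi := integrable_mix_rpow_one_sub hq0 hq1 hα v (v / 2)
  have hi' := integrable_mix_rpow hq0 hq1.le hα v (v / 2)
  have h1 := integrable_and_integral_exp_mul_comp_inv v
    (f := fun z => (q * z + (1 - q)) ^ (1 - α)) hi
  have h2 := integrable_and_integral_exp_mul_comp_inv v (f := fun z => (q * z + (1 - q)) ^ α) hi'
  have h := integral_mono (hi.add h1.1) (hi'.add h2.1) fun t =>
    mix_rpow_symm_le hq0 hq1.le (Real.exp_pos (t - v / 2)) hα
  rw [integral_add' hi h1.1, integral_add' hi' h2.1, h1.2, h2.2] at h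
  rw [mixMoment]
  linarith

end LogNormal

section RenyiConvexity

lemma sum_div_sum_rpow_mul_le {ι : Type*} {J : Finset ι} (hJ : J.Nonempty) {P Q : ι → ℝ}
    (hP : ∀ j ∈ J, 0 ≤ P j) (hQ : ∀ j ∈ J, 0 < Q j) {α : ℝ} (hα : 1 ≤ α) :
    ((∑ j ∈ J, P j) / ∑ j ∈ J, Q j) ^ α * ∑ j ∈ J, Q j ≤ ∑ j ∈ J, (P j / Q j) ^ α * Q j := by
  have hS : 0 < ∑ j ∈ J, Q j := Finset.sum_pos hQ hJ
  have h := Real.rpow_arith_mean_le_arith_mean_rpow J (fun j => Q j / ∑ j ∈ J, Q j)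
    (fun j => P j / Q j) (fun j hj => div_nonneg (hQ j hj).le hS.le)
    (by rw [← Finset.sum_div, div_self hS.ne']) (fun j hj => div_nonneg (hP j hj) (hQ j hj).le) hα
  have h1 : ∑ j ∈ J, Q j / (∑ j ∈ J, Q j) * (P j / Q j) = (∑ j ∈ J, P j) / ∑ j ∈ J, Q j := by
    rw [Finset.sum_div]
    refine Finset.sum_congr rfl fun j hj => ?_
    have := (hQ j hj).ne'
    field_simp
  rw [h1] at h
  calc _ ≤ (∑ j ∈ J, Q j / (∑ j ∈ J, Q j) * (P j / Q j) ^ α) * ∑ j ∈ J, Q j := by gcongr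
    _ = _ := by
      rw [Finset.sum_mul]
      refine Finset.sum_congr rfl fun j _ => ?_
      field_simp

lemma renyiDiv_average_le {Ω ι : Type*} [MeasurableSpace Ω] {ν : Measure Ω} {J : Finset ι}
    (hJ : J.Nonempty) {P Q : ι → Ω → ℝ} (hP : ∀ j ∈ J, ∀ x, 0 ≤ P j x)
    (hQ : ∀ j ∈ J, ∀ x, 0 < Q j x) {α R : ℝ} (hα : 1 < α) (hR : 1 ≤ R)
    (hi : ∀ j ∈ J, Integrable (fun x => (P j x / Q j x) ^ α * Q j x) ν)
    (hle : ∀ j ∈ J, ∫ x, (P j x / Q j x) ^ α * Q j x ∂ν ≤ R) :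
    renyiDiv ν α (fun x => (J.card : ℝ)⁻¹ * ∑ j ∈ J, P j x)
      (fun x => (J.card : ℝ)⁻¹ * ∑ j ∈ J, Q j x) ≤ (α - 1)⁻¹ * Real.log R := by
  have hc : (0 : ℝ) < J.card := by exact_mod_cast hJ.card_pos
  have hSP : ∀ x, 0 ≤ ∑ j ∈ J, P j x := fun x => Finset.sum_nonneg fun j hj => hP j hj x
  have hSQ : ∀ x, 0 < ∑ j ∈ J, Q j x := fun x => Finset.sum_pos (fun j hj => hQ j hj x) hJ
  have h0 : ∀ x, 0 ≤ (((J.card : ℝ)⁻¹ * ∑ j ∈ J, P j x) / ((J.card : ℝ)⁻¹ * ∑ j ∈ J, Q j x)) ^ α *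
      ((J.card : ℝ)⁻¹ * ∑ j ∈ J, Q j x) := fun x => by
    have := hSP x
    have := (hSQ x).le
    positivity
  have hbound : ∫ x, (((J.card : ℝ)⁻¹ * ∑ j ∈ J, P j x) / ((J.card : ℝ)⁻¹ * ∑ j ∈ J, Q j x)) ^ α *
      ((J.card : ℝ)⁻¹ * ∑ j ∈ J, Q j x) ∂ν ≤ R := by
    calc _ ≤ ∫ x, (J.card : ℝ)⁻¹ * ∑ j ∈ J, (P j x / Q j x) ^ α * Q j x ∂ν := by
          refine integral_mono_of_nonneg (Filter.Eventually.of_forall h0)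
            ((integrable_finsetSum J hi).const_mul _) (Filter.Eventually.of_forall fun x => ?_)
          have h := sum_div_sum_rpow_mul_le hJ (fun j hj => hP j hj x) (fun j hj => hQ j hj x) hα.le
          simp only
          rw [mul_div_mul_left _ _ (inv_ne_zero hc.ne'), mul_left_comm]
          gcongr
      _ ≤ (J.card : ℝ)⁻¹ * ∑ _j ∈ J, R := by
          rw [integral_const_mul, integral_finsetSum J hi]
          gcongr with j hj
          exact hle j hj
      _ = R := by
          rw [Finset.sum_const, nsmul_eq_mul, inv_mul_cancel_left₀ hc.ne']
  refine mul_le_mul_of_nonneg_left ?_ (inv_nonneg.2 (sub_pos.2 hα).le)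
  have hnn : 0 ≤ ∫ x, (((J.card : ℝ)⁻¹ * ∑ j ∈ J, P j x) /
      ((J.card : ℝ)⁻¹ * ∑ j ∈ J, Q j x)) ^ α * ((J.card : ℝ)⁻¹ * ∑ j ∈ J, Q j x) ∂ν :=
    integral_nonneg h0
  rcases hnn.eq_or_lt with h | h
  · rw [← h, Real.log_zero]
    exact Real.log_nonneg hR
  · exact Real.log_le_log h hbound

end RenyiConvexity

section GaussianMixture

variable {E : Type*} [NormedAddCommGroup E] [InnerProductSpace ℝ E] [FiniteDimensional ℝ E]
  [MeasurableSpace E] [BorelSpace E]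

omit [FiniteDimensional ℝ E] [MeasurableSpace E] [BorelSpace E] in
lemma mix_div_rpow_mul (μ₀ μ₁ : E) {s : ℝ} (hs : 0 < s) (q α : ℝ) (x : E) :
    ((q * isoGauss μ₁ s x + (1 - q) * isoGauss μ₀ s x) / isoGauss μ₀ s x) ^ α * isoGauss μ₀ s x =
      (q * (isoGauss μ₁ s x / isoGauss μ₀ s x) + (1 - q)) ^ α * isoGauss μ₀ s x := by
  have := (isoGauss_pos μ₀ hs x).ne'
  congr 2
  field_simp

omit [FiniteDimensional ℝ E] [MeasurableSpace E] [BorelSpace E] in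
lemma div_mix_rpow_mul (μ₀ μ₁ : E) {s : ℝ} (hs : 0 < s) {q : ℝ} (hq0 : 0 ≤ q) (hq1 : q < 1)
    (α : ℝ) (x : E) :
    (isoGauss μ₀ s x / (q * isoGauss μ₁ s x + (1 - q) * isoGauss μ₀ s x)) ^ α *
        (q * isoGauss μ₁ s x + (1 - q) * isoGauss μ₀ s x) =
      (q * (isoGauss μ₁ s x / isoGauss μ₀ s x) + (1 - q)) ^ (1 - α) * isoGauss μ₀ s x := by
  have h0 := isoGauss_pos μ₀ hs x
  have h1 := isoGauss_pos μ₁ hs x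
  have hq : 0 < 1 - q := sub_pos.2 hq1
  set w := q * (isoGauss μ₁ s x / isoGauss μ₀ s x) + (1 - q) with hw
  have hw0 : 0 < w := by positivity
  have h2 : q * isoGauss μ₁ s x + (1 - q) * isoGauss μ₀ s x = w * isoGauss μ₀ s x := by
    rw [hw]; field_simp
  rw [h2, div_mul_cancel_right₀ h0.ne', Real.inv_rpow hw0.le, Real.rpow_sub hw0, Real.rpow_one]
  ring

lemma integral_mix_div_rpow (μ₀ μ₁ : E) {s : ℝ} (hs : 0 < s) {q α : ℝ} (hq0 : 0 ≤ q) (hq1 : q ≤ 1)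
    (hα : 1 ≤ α) :
    Integrable (fun x => ((q * isoGauss μ₁ s x + (1 - q) * isoGauss μ₀ s x) / isoGauss μ₀ s x) ^ α *
        isoGauss μ₀ s x) ∧
      ∫ x, ((q * isoGauss μ₁ s x + (1 - q) * isoGauss μ₀ s x) / isoGauss μ₀ s x) ^ α *
        isoGauss μ₀ s x = mixMoment α q (‖μ₁ - μ₀‖ ^ 2 / s ^ 2).toNNReal := by
  simp_rw [mix_div_rpow_mul μ₀ μ₁ hs]
  exact ⟨integrable_comp_isoGauss_div μ₀ μ₁ hs (f := fun z => (q * z + (1 - q)) ^ α) (by fun_prop)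
      (integrable_mix_rpow hq0 hq1 hα _ _),
    integral_comp_isoGauss_div μ₀ μ₁ hs (f := fun z => (q * z + (1 - q)) ^ α) (by fun_prop)⟩

lemma integral_div_mix_rpow_le (μ₀ μ₁ : E) {s : ℝ} (hs : 0 < s) {q α : ℝ} (hq0 : 0 ≤ q)
    (hq1 : q < 1) (hα : 1 ≤ α) :
    Integrable (fun x => (isoGauss μ₀ s x / (q * isoGauss μ₁ s x + (1 - q) * isoGauss μ₀ s x)) ^ α *
        (q * isoGauss μ₁ s x + (1 - q) * isoGauss μ₀ s x)) ∧
      ∫ x, (isoGauss μ₀ s x / (q * isoGauss μ₁ s x + (1 - q) * isoGauss μ₀ s x)) ^ α *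
        (q * isoGauss μ₁ s x + (1 - q) * isoGauss μ₀ s x) ≤
        mixMoment α q (‖μ₁ - μ₀‖ ^ 2 / s ^ 2).toNNReal := by
  simp_rw [div_mix_rpow_mul μ₀ μ₁ hs hq0 hq1]
  refine ⟨integrable_comp_isoGauss_div μ₀ μ₁ hs (f := fun z => (q * z + (1 - q)) ^ (1 - α))
      (by fun_prop) (integrable_mix_rpow_one_sub hq0 hq1 hα _ _), ?_⟩
  rw [integral_comp_isoGauss_div μ₀ μ₁ hs (f := fun z => (q * z + (1 - q)) ^ (1 - α)) (by fun_prop)]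
  exact integral_mix_rpow_one_sub_le hq0 hq1 hα _

end GaussianMixture

lemma renyiDiv_gauss1_mix {q α σ : ℝ} (hσ : 0 < σ) (hq0 : 0 ≤ q) (hq1 : q ≤ 1) (hα : 1 ≤ α) :
    renyiDiv volume α (fun t => q * gauss1 1 (σ / 2) t + (1 - q) * gauss1 0 (σ / 2) t)
      (fun t => gauss1 0 (σ / 2) t) =
      (α - 1)⁻¹ * Real.log (mixMoment α q (4 / σ ^ 2).toNNReal) := by
  rw [renyiDiv]
  simp_rw [gauss1_eq_isoGauss]
  rw [(integral_mix_div_rpow (0 : ℝ) 1 (half_pos hσ) hq0 hq1 hα).2]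
  congr 4
  norm_num
  field_simp
  norm_num

section Combinatorics

variable {ι : Type*} [DecidableEq ι]

/-- Pairs of a size-`k` subset of `s` and one of its elements. -/
def pointedSubsets (k : ℕ) (s : Finset ι) : Finset (Σ _ : Finset ι, ι) :=
  (powersetCard k s).sigma fun c => c

omit [DecidableEq ι] in
lemma sum_pointedSubsets_fst (k : ℕ) (s : Finset ι) (F : Finset ι → ℝ) :
    ∑ j ∈ pointedSubsets k s, F j.1 = k * ∑ c ∈ powersetCard k s, F c := by
  rw [pointedSubsets, Finset.sum_sigma, Finset.mul_sum]
  refine Finset.sum_congr rfl fun c hc => ?_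
  rw [Finset.sum_const (F c), (mem_powersetCard.1 hc).2, nsmul_eq_mul]

omit [DecidableEq ι] in
lemma card_pointedSubsets (k : ℕ) (s : Finset ι) :
    (pointedSubsets k s).card = k * s.card.choose k := by
  have h := sum_pointedSubsets_fst k s fun _ => 1
  simp only [sum_const, card_powersetCard, nsmul_eq_mul, mul_one] at h
  exact_mod_cast h

lemma sum_pointedSubsets_erase (k : ℕ) (s : Finset ι) (F : Finset ι → ℝ) :
    ∑ j ∈ pointedSubsets (k + 1) s, F (j.1.erase j.2) =
      ((s.card - k : ℕ) : ℝ) * ∑ c ∈ powersetCard k s, F c := by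
  have h : ∑ j ∈ pointedSubsets (k + 1) s, F (j.1.erase j.2) =
      ∑ j ∈ (powersetCard k s).sigma (fun c => s \ c), F j.1 := by
    refine Finset.sum_bij' (fun j _ => ⟨j.1.erase j.2, j.2⟩) (fun j _ => ⟨insert j.2 j.1, j.2⟩)
      ?_ ?_ ?_ ?_ ?_
    · rintro ⟨c, j⟩ h
      simp only [pointedSubsets, mem_sigma, mem_powersetCard, mem_sdiff] at h ⊢
      exact ⟨⟨(erase_subset _ _).trans h.1.1, by rw [card_erase_of_mem h.2, h.1.2]; rfl⟩,
        h.1.1 h.2, notMem_erase _ _⟩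
    · rintro ⟨c, j⟩ h
      simp only [pointedSubsets, mem_sigma, mem_powersetCard, mem_sdiff] at h ⊢
      exact ⟨⟨insert_subset h.2.1 h.1.1, by rw [card_insert_of_notMem h.2.2, h.1.2]⟩,
        mem_insert_self _ _⟩
    · rintro ⟨c, j⟩ h
      simp only [pointedSubsets, mem_sigma] at h
      simp [insert_erase h.2]
    · rintro ⟨c, j⟩ h
      simp only [mem_sigma, mem_sdiff] at h
      simp [erase_insert h.2.2]
    · rintro ⟨c, j⟩ _
      rfl
  rw [h, Finset.sum_sigma, Finset.mul_sum]
  refine Finset.sum_congr rfl fun c hc => ?_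
  rw [mem_powersetCard] at hc
  rw [Finset.sum_const (F c), card_sdiff_of_subset hc.1, hc.2, nsmul_eq_mul]

lemma sum_powersetCard_succ_insert {i : ι} {s : Finset ι} (hi : i ∉ s) (k : ℕ)
    (F : Finset ι → ℝ) :
    ∑ c ∈ powersetCard (k + 1) (insert i s), F c =
      ∑ c ∈ powersetCard (k + 1) s, F c + ∑ c ∈ powersetCard k s, F (insert i c) := by
  have hni : ∀ n, ∀ c ∈ powersetCard n s, i ∉ c := fun n c hc h =>
    hi ((mem_powersetCard.1 hc).1 h)
  rw [Finset.powersetCard_succ_insert hi, Finset.sum_union, Finset.sum_image]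
  · intro c hc d hd h
    rw [← erase_insert (hni k c hc), ← erase_insert (hni k d hd), h]
  · rw [Finset.disjoint_left]
    intro c hc hc'
    obtain ⟨d, _, rfl⟩ := mem_image.1 hc'
    exact hni _ _ hc (mem_insert_self _ _)

omit [DecidableEq ι] in
lemma average_powersetCard_eq {k : ℕ} {s : Finset ι} (hk : 1 ≤ k) (F : Finset ι → ℝ) :
    ((s.card.choose k : ℕ) : ℝ)⁻¹ * ∑ c ∈ powersetCard k s, F c =
      ((pointedSubsets k s).card : ℝ)⁻¹ * ∑ j ∈ pointedSubsets k s, F j.1 := by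
  have h1 : (k : ℝ) ≠ 0 := by exact_mod_cast (by omega : k ≠ 0)
  rw [card_pointedSubsets, sum_pointedSubsets_fst]
  push_cast
  field_simp

lemma average_powersetCard_insert_eq {i : ι} {k : ℕ} {s : Finset ι} (hi : i ∉ s) (hk : 1 ≤ k)
    (hks : k ≤ s.card) (F : Finset ι → ℝ) :
    (((s.card + 1).choose k : ℕ) : ℝ)⁻¹ * ∑ c ∈ powersetCard k (insert i s), F c =
      ((pointedSubsets k s).card : ℝ)⁻¹ * ∑ j ∈ pointedSubsets k s,
        ((k : ℝ) / ((s.card + 1 : ℕ) : ℝ) * F (insert i (j.1.erase j.2)) +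
          (1 - (k : ℝ) / ((s.card + 1 : ℕ) : ℝ)) * F j.1) := by
  obtain ⟨k, rfl⟩ := Nat.exists_eq_add_of_le' hk
  rw [Finset.sum_add_distrib, ← Finset.mul_sum, ← Finset.mul_sum, sum_pointedSubsets_fst,
    sum_pointedSubsets_erase k s (fun c => F (insert i c)), sum_powersetCard_succ_insert hi,
    card_pointedSubsets]
  have hsub : ((s.card - k : ℕ) : ℝ) = s.card - k := Nat.cast_sub (by omega)
  have hC := Nat.choose_mul_succ_eq s.card (k + 1)
  rw [show s.card + 1 - (k + 1) = s.card - k by omega] at hC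
  have hC' : (s.card.choose (k + 1) : ℝ) * (s.card + 1) =
      (s.card + 1).choose (k + 1) * (s.card - k) := by
    rw [← hsub]
    exact_mod_cast hC
  have h1 : ((s.card + 1).choose (k + 1) : ℝ) ≠ 0 := by
    exact_mod_cast (Nat.choose_pos (by omega)).ne'
  have h2 : (s.card.choose (k + 1) : ℝ) ≠ 0 := by
    exact_mod_cast (Nat.choose_pos hks).ne'
  have h3 : (s.card : ℝ) + 1 ≠ 0 := by positivity
  have h4 : (k : ℝ) + 1 ≠ 0 := by positivity
  rw [hsub]
  push_cast
  field_simp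
  linear_combination (∑ c ∈ powersetCard (k + 1) s, F c + ∑ c ∈ powersetCard k s, F (insert i c)) * hC'

end Combinatorics

section TransitionDensity

lemma norm_clip_le {E : Type*} [NormedAddCommGroup E] [NormedSpace ℝ E] {C : ℝ} (hC : 0 < C)
    (x : E) : ‖clip C x‖ ≤ C := by
  have hm : 0 < max 1 (‖x‖ / C) := lt_max_of_lt_left one_pos
  rw [clip, norm_smul, norm_inv, Real.norm_of_nonneg hm.le, inv_mul_le_iff₀ hm, ← div_le_iff₀ hC]
  exact le_max_right _ _

variable {X : Type*} {p n : ℕ} (C η σ : ℝ) (k : ℕ)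
  (g : EuclideanSpace ℝ (Fin p) → X → EuclideanSpace ℝ (Fin p))
  (D : Fin (n + 1) → X) (θ : EuclideanSpace ℝ (Fin p)) (i : Fin (n + 1))

lemma pFSwoR_removeIdx_eq (hk : 1 ≤ k) :
    pFSwoR C η σ k g n (removeIdx i D) θ = fun x =>
      ((pointedSubsets k (univ.erase i)).card : ℝ)⁻¹ * ∑ j ∈ pointedSubsets k (univ.erase i),
        isoGauss (muStep C η k g θ j.1 D) (C * η * σ / k) x := by
  ext x
  have hs : (univ.erase i : Finset (Fin (n + 1))) = univ.map i.succAboveEmb := by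
    ext j
    simp [Fin.exists_succAbove_eq_iff]
  have hcard : (univ.erase i : Finset (Fin (n + 1))).card = n := by simp
  rw [← average_powersetCard_eq hk fun b =>
    isoGauss (muStep C η k g θ b D) (C * η * σ / k) x, hcard, hs, powersetCard_map, sum_map, pFSwoR]
  refine congrArg _ (Finset.sum_congr rfl fun b _ => ?_)
  rw [gaussND_eq_isoGauss]
  simp [muStep, removeIdx, mapEmbedding_apply]

lemma pFSwoR_succ_eq (hk : 1 ≤ k) (hkn : k ≤ n) :
    pFSwoR C η σ k g (n + 1) D θ = fun x =>
      ((pointedSubsets k (univ.erase i)).card : ℝ)⁻¹ * ∑ j ∈ pointedSubsets k (univ.erase i),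
        ((k : ℝ) / ((n + 1 : ℕ) : ℝ) *
            isoGauss (muStep C η k g θ (insert i (j.1.erase j.2)) D) (C * η * σ / k) x +
          (1 - (k : ℝ) / ((n + 1 : ℕ) : ℝ)) *
            isoGauss (muStep C η k g θ j.1 D) (C * η * σ / k) x) := by
  ext x
  have hcard : (univ.erase i : Finset (Fin (n + 1))).card = n := by simp
  have h := average_powersetCard_insert_eq (notMem_erase i univ) hk (hcard.symm ▸ hkn)
    fun b => isoGauss (muStep C η k g θ b D) (C * η * σ / k) x
  rw [hcard, insert_erase (mem_univ i)] at h
  rw [← h, pFSwoR]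
  simp_rw [gaussND_eq_isoGauss]

variable {C η σ k}

lemma norm_muStep_insert_erase_sub_sq_div_le (hC : 0 < C) (hη : 0 < η) (hσ : 0 < σ) (hk : 1 ≤ k)
    {j : Σ _ : Finset (Fin (n + 1)), Fin (n + 1)} (hj : j ∈ pointedSubsets k (univ.erase i)) :
    (‖muStep C η k g θ (insert i (j.1.erase j.2)) D - muStep C η k g θ j.1 D‖ ^ 2 /
      (C * η * σ / k) ^ 2).toNNReal ≤ (4 / σ ^ 2).toNNReal := by
  obtain ⟨c, l⟩ := j
  simp only [pointedSubsets, mem_sigma, mem_powersetCard] at hj ⊢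
  have hic : i ∉ c := fun h => notMem_erase i univ (hj.1.1 h)
  have hk0 : (0 : ℝ) < k := by exact_mod_cast hk
  have hdiff : muStep C η k g θ (insert i (c.erase l)) D - muStep C η k g θ c D =
      (η / k) • (clip C (g θ (D l)) - clip C (g θ (D i))) := by
    rw [muStep, muStep, sum_insert fun h => hic (mem_of_mem_erase h), ← add_sum_erase c _ hj.2]
    module
  have hnorm : ‖muStep C η k g θ (insert i (c.erase l)) D - muStep C η k g θ c D‖ ≤
      η / k * (C + C) := by
    rw [hdiff, norm_smul, Real.norm_of_nonneg (by positivity)]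
    gcongr
    exact (norm_sub_le _ _).trans (add_le_add (norm_clip_le hC _) (norm_clip_le hC _))
  refine Real.toNNReal_le_toNNReal ?_
  calc _ ≤ (η / k * (C + C)) ^ 2 / (C * η * σ / k) ^ 2 := by gcongr
    _ = 4 / σ ^ 2 := by field_simp; norm_num

lemma renyiDiv_pFSwoR_remove_le (hC : 0 < C) (hη : 0 < η) (hσ : 0 < σ) (hk : 1 ≤ k) (hkn : k ≤ n)
    {α : ℝ} (hα : 1 < α) :
    renyiDiv volume α (pFSwoR C η σ k g (n + 1) D θ) (pFSwoR C η σ k g n (removeIdx i D) θ) ≤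
      (α - 1)⁻¹ * Real.log (mixMoment α ((k : ℝ) / ((n + 1 : ℕ) : ℝ)) (4 / σ ^ 2).toNNReal) := by
  have hk0 : (0 : ℝ) < k := by exact_mod_cast hk
  have hs : 0 < C * η * σ / k := by positivity
  have hq0 : 0 ≤ (k : ℝ) / ((n + 1 : ℕ) : ℝ) := by positivity
  have hq1 : (k : ℝ) / ((n + 1 : ℕ) : ℝ) ≤ 1 :=
    div_le_one_of_le₀ (by exact_mod_cast (by omega : k ≤ n + 1)) (by positivity)
  have hJ : (pointedSubsets k (univ.erase i)).Nonempty := by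
    rw [← card_pos, card_pointedSubsets]
    exact Nat.mul_pos hk (Nat.choose_pos (by simpa using hkn))
  rw [pFSwoR_succ_eq C η σ k g D θ i hk hkn, pFSwoR_removeIdx_eq C η σ k g D θ i hk]
  refine renyiDiv_average_le hJ (fun j _ x => ?_) (fun j _ x => isoGauss_pos _ hs x) hα
    (one_le_mixMoment hq0 hq1 hα.le _)
    (fun j _ => (integral_mix_div_rpow _ _ hs hq0 hq1 hα.le).1) (fun j hj => ?_)
  · exact add_nonneg (mul_nonneg hq0 (isoGauss_pos _ hs x).le)
      (mul_nonneg (sub_nonneg.2 hq1) (isoGauss_pos _ hs x).le)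
  · rw [(integral_mix_div_rpow _ _ hs hq0 hq1 hα.le).2]
    exact mixMoment_mono_var hq0 hq1 hα.le
      (norm_muStep_insert_erase_sub_sq_div_le g D θ i hC hη hσ hk hj)

lemma renyiDiv_pFSwoR_add_le (hC : 0 < C) (hη : 0 < η) (hσ : 0 < σ) (hk : 1 ≤ k) (hkn : k ≤ n)
    {α : ℝ} (hα : 1 < α) :
    renyiDiv volume α (pFSwoR C η σ k g n (removeIdx i D) θ) (pFSwoR C η σ k g (n + 1) D θ) ≤
      (α - 1)⁻¹ * Real.log (mixMoment α ((k : ℝ) / n) (4 / σ ^ 2).toNNReal) := by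
  have hk0 : (0 : ℝ) < k := by exact_mod_cast hk
  have hn0 : (0 : ℝ) < n := by exact_mod_cast hk.trans hkn
  have hs : 0 < C * η * σ / k := by positivity
  have hq0 : 0 ≤ (k : ℝ) / ((n + 1 : ℕ) : ℝ) := by positivity
  have hq1 : (k : ℝ) / ((n + 1 : ℕ) : ℝ) < 1 := by
    rw [div_lt_one (by positivity)]
    exact_mod_cast (by omega : k < n + 1)
  have hqq : (k : ℝ) / ((n + 1 : ℕ) : ℝ) ≤ k / n := by
    gcongr
    exact Nat.le_succ n
  have hq1' : (k : ℝ) / n ≤ 1 := div_le_one_of_le₀ (by exact_mod_cast hkn) hn0.le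
  have hJ : (pointedSubsets k (univ.erase i)).Nonempty := by
    rw [← card_pos, card_pointedSubsets]
    exact Nat.mul_pos hk (Nat.choose_pos (by simpa using hkn))
  rw [pFSwoR_succ_eq C η σ k g D θ i hk hkn, pFSwoR_removeIdx_eq C η σ k g D θ i hk]
  refine renyiDiv_average_le hJ (fun j _ x => (isoGauss_pos _ hs x).le) (fun j _ x => ?_) hα
    (one_le_mixMoment (hq0.trans hqq) hq1' hα.le _)
    (fun j _ => (integral_div_mix_rpow_le _ _ hs hq0 hq1 hα.le).1) (fun j hj => ?_)
  · exact add_pos_of_nonneg_of_pos (mul_nonneg hq0 (isoGauss_pos _ hs x).le)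
      (mul_pos (sub_pos.2 hq1) (isoGauss_pos _ hs x))
  · exact (integral_div_mix_rpow_le _ _ hs hq0 hq1 hα.le).2.trans
      ((mixMoment_mono_var hq0 hq1.le hα.le
        (norm_muStep_insert_erase_sub_sq_div_le g D θ i hC hη hσ hk hj)).trans
      (mixMoment_mono_weight hq0 hqq hq1' hα.le _))

end TransitionDensity

/-- Theorem: one-step FSwoR Rényi bound, add/remove adjacency. -/
theorem stmt0 {X : Type*} {pd : ℕ} (hpd : 1 ≤ pd)
    (C η σ : ℝ) (hC : 0 < C) (hη : 0 < η) (hσ : 0 < σ)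
    (k : ℕ) (hk : 1 ≤ k)
    (g : EuclideanSpace ℝ (Fin pd) → X → EuclideanSpace ℝ (Fin pd))
    {nD nD' : ℕ} (D : Fin nD → X) (D' : Fin nD' → X)
    (hadj : AdjAddRemove D D') (hkmin : k ≤ min nD nD')
    (α : ℝ) (hα : 1 < α) :
    ∀ θ : EuclideanSpace ℝ (Fin pd),
      renyiDiv volume α (pFSwoR C η σ k g nD D θ) (pFSwoR C η σ k g nD' D' θ) ≤
        renyiDiv volume α
          (fun t => (k : ℝ) / nD * gauss1 1 (σ / 2) t +
            (1 - (k : ℝ) / nD) * gauss1 0 (σ / 2) t)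
          (fun t => gauss1 0 (σ / 2) t) := by
  intro θ
  have hq0 : ∀ m : ℕ, (0 : ℝ) ≤ (k : ℝ) / m := fun m => by positivity
  have hq1 : (k : ℝ) / nD ≤ 1 :=
    div_le_one_of_le₀ (by exact_mod_cast hkmin.trans (min_le_left _ _)) (Nat.cast_nonneg _)
  rw [renyiDiv_gauss1_mix hσ (hq0 _) hq1 hα.le]
  rcases hadj with ⟨rfl, i, rfl⟩ | ⟨rfl, i, rfl⟩
  · exact renyiDiv_pFSwoR_remove_le g D θ i hC hη hσ hk (hkmin.trans (min_le_right _ _)) hα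
  · exact renyiDiv_pFSwoR_add_le g D' θ i hC hη hσ hk (hkmin.trans (min_le_left _ _)) hα
end
end

section
/- For every α > 1, σ > 0 and 0 ≤ q < 1, one has |H_{α,σ}(q) − 1 − (q²/2)·α·(α−1)·M_{σ,2}| ≤ R̃_{α,σ,3}(q); that is, the third-order Taylor remainder R_{α,σ,3}(q) = H_{α,σ}(q) − 1 − (q²/2)·α·(α−1)·M_{σ,2} satisfies |R_{α,σ,3}(q)| ≤ R̃_{α,σ,3}(q). -/
open MeasureTheory Finset

noncomputable section

lemma abs_le_of_abs_deriv_le {f f' g g' : ℝ → ℝ}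
    (hf : ∀ t ∈ Set.Icc (0 : ℝ) 1, HasDerivAt f (f' t) t)
    (hg : ∀ t ∈ Set.Icc (0 : ℝ) 1, HasDerivAt g (g' t) t)
    (hf0 : f 0 = 0) (hg0 : g 0 = 0)
    (hfg : ∀ t ∈ Set.Icc (0 : ℝ) 1, |f' t| ≤ g' t) :
    ∀ t ∈ Set.Icc (0 : ℝ) 1, |f t| ≤ g t := by
  intro t ht
  exact image_norm_le_of_norm_deriv_right_le_deriv_boundary' (f := f) (f' := f') (a := 0) (b := 1)
    (fun x hx => (hf x hx).continuousAt.continuousWithinAt)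
    (fun x hx => (hf x (Set.Ico_subset_Icc_self hx)).hasDerivWithinAt)
    (by simp [hf0, hg0])
    (fun x hx => (hg x hx).continuousAt.continuousWithinAt)
    (fun x hx => (hg x (Set.Ico_subset_Icc_self hx)).hasDerivWithinAt)
    (fun x hx => hfg x (Set.Ico_subset_Icc_self hx)) ht

lemma one_add_mul_pos {t y : ℝ} (hy : -1 < y) (ht : t ∈ Set.Icc (0 : ℝ) 1) : 0 < 1 + t * y := by
  rcases le_total 0 y with h | h
  · have := mul_nonneg ht.1 h
    linarith
  · nlinarith [ht.1, ht.2]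

lemma hasDerivAt_one_add_mul_rpow {t y : ℝ} (β : ℝ) (h : 0 < 1 + t * y) :
    HasDerivAt (fun s : ℝ => (1 + s * y) ^ β) (β * y * (1 + t * y) ^ (β - 1)) t := by
  have h1 : HasDerivAt (fun s : ℝ => 1 + s * y) y t := by
    simpa using ((hasDerivAt_id t).mul_const y).const_add 1
  convert h1.rpow_const (p := β) (Or.inl h.ne') using 1
  ring

/-- A majorant of the third derivative of `t ↦ (1 + t y) ^ α` on `[0, 1]`, integrated three times
from `0`, bounds the second-order Taylor remainder of `(1 + y) ^ α`. -/
lemma abs_rpow_taylor_le {α y : ℝ} (hy : -1 < y) {g₀ g₁ g₂ g₃ : ℝ → ℝ}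
    (h₀ : ∀ t, HasDerivAt g₀ (g₁ t) t) (h₁ : ∀ t, HasDerivAt g₁ (g₂ t) t)
    (h₂ : ∀ t, HasDerivAt g₂ (g₃ t) t) (z₀ : g₀ 0 = 0) (z₁ : g₁ 0 = 0) (z₂ : g₂ 0 = 0)
    (hb : ∀ t ∈ Set.Icc (0 : ℝ) 1,
      |α * (α - 1) * (α - 2)| * |y| ^ 3 * (1 + t * y) ^ (α - 3) ≤ g₃ t) :
    |(1 + y) ^ α - 1 - α * y - α * (α - 1) / 2 * y ^ 2| ≤ g₀ 1 := by
  have e₂ := abs_le_of_abs_deriv_le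
    (f := fun t => α * (α - 1) * y ^ 2 * ((1 + t * y) ^ (α - 2) - 1))
    (f' := fun t => α * (α - 1) * (α - 2) * y ^ 3 * (1 + t * y) ^ (α - 3)) (g := g₂) (g' := g₃)
    (fun t ht => by
      refine (((hasDerivAt_one_add_mul_rpow (α - 2) (one_add_mul_pos hy ht)).sub_const 1).const_mul
        (α * (α - 1) * y ^ 2)).congr_deriv ?_
      rw [show α - 2 - 1 = α - 3 by ring]; ring)
    (fun t _ => h₂ t) (by simp) z₂
    (fun t ht => by
      refine le_trans (le_of_eq ?_) (hb t ht)
      rw [abs_mul _ (_ ^ (α - 3)), abs_mul _ (y ^ 3), abs_pow,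
        abs_of_pos (Real.rpow_pos_of_pos (one_add_mul_pos hy ht) _)])
  have e₁ := abs_le_of_abs_deriv_le
    (f := fun t => α * y * ((1 + t * y) ^ (α - 1) - 1 - (α - 1) * y * t)) (g := g₁) (g' := g₂)
    (fun t ht => by
      refine ((((hasDerivAt_one_add_mul_rpow (α - 1) (one_add_mul_pos hy ht)).sub_const 1).sub
        ((hasDerivAt_id' t).const_mul ((α - 1) * y))).const_mul (α * y)).congr_deriv ?_
      rw [show α - 1 - 1 = α - 2 by ring]; ring)
    (fun t _ => h₁ t) (by simp) z₁ e₂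
  have e₀ := abs_le_of_abs_deriv_le
    (f := fun t => (1 + t * y) ^ α - 1 - α * y * t - α * (α - 1) / 2 * y ^ 2 * t ^ 2)
    (g := g₀) (g' := g₁)
    (fun t ht => by
      refine ((((hasDerivAt_one_add_mul_rpow α (one_add_mul_pos hy ht)).sub_const 1).sub
        ((hasDerivAt_id' t).const_mul (α * y))).sub
        ((hasDerivAt_pow 2 t).const_mul (α * (α - 1) / 2 * y ^ 2))).congr_deriv ?_
      norm_num
      ring)
    (fun t _ => h₀ t) (by simp) z₀ e₁
  simpa using e₀ 1 (by simp)

lemma abs_rpow_taylor_le_of_le {α y C : ℝ} (hy : -1 < y)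
    (hC : ∀ t ∈ Set.Icc (0 : ℝ) 1, (1 + t * y) ^ (α - 3) ≤ C) :
    |(1 + y) ^ α - 1 - α * y - α * (α - 1) / 2 * y ^ 2| ≤
      |α * (α - 1) * (α - 2)| * (1 / 6 * C * |y| ^ 3) := by
  set K := |α * (α - 1) * (α - 2)| * |y| ^ 3 with hK
  refine (abs_rpow_taylor_le hy (g₀ := fun t => K * C / 6 * t ^ 3)
    (g₁ := fun t => K * C / 2 * t ^ 2) (g₂ := fun t => K * C * t) (g₃ := fun _ => K * C)
    (fun t => ?_) (fun t => ?_) (fun t => ?_) (by simp) (by simp) (by simp)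
    (fun t ht => mul_le_mul_of_nonneg_left (hC t ht) (by positivity))).trans (le_of_eq ?_)
  · refine ((hasDerivAt_pow 3 t).const_mul (K * C / 6)).congr_deriv ?_
    norm_num
    ring
  · refine ((hasDerivAt_pow 2 t).const_mul (K * C / 2)).congr_deriv ?_
    norm_num
    ring
  · simpa using (hasDerivAt_id t).const_mul (K * C)
  · rw [hK]; ring

/-- Third-order tail of the binomial expansion of `(1 + y) ^ (n + 3)`, normalised so that its
third derivative is `(1 + y) ^ n`. -/
lemma sum_factorial_mul_pow_eq (n : ℕ) (y : ℝ) :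
    ∑ ℓ ∈ Finset.range (n + 1),
        (n.factorial : ℝ) / (((n - ℓ).factorial : ℝ) * ((3 + ℓ).factorial : ℝ)) * y ^ (ℓ + 3) =
      ((1 + y) ^ (n + 3) - 1 - (n + 3) * y - (n + 3) * (n + 2) / 2 * y ^ 2) /
        ((n + 1) * (n + 2) * (n + 3)) := by
  have hpos : ((n : ℝ) + 1) * (n + 2) * (n + 3) ≠ 0 := by positivity
  rw [eq_div_iff hpos, add_comm 1 y, add_pow]
  simp only [one_pow, mul_one]
  have c2 : (((n + 3).choose 2 : ℕ) : ℝ) = (n + 3) * (n + 2) / 2 := by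
    rw [Nat.cast_choose_two]; push_cast; ring
  have key : ∑ k ∈ Finset.range (n + 1), y ^ (k + 1 + 1 + 1) * ((n + 3).choose (k + 1 + 1 + 1) : ℝ)
      = (∑ ℓ ∈ Finset.range (n + 1), (n.factorial : ℝ) /
        (((n - ℓ).factorial : ℝ) * ((3 + ℓ).factorial : ℝ)) * y ^ (ℓ + 3)) *
        ((n + 1) * (n + 2) * (n + 3)) := by
    rw [Finset.sum_mul]
    refine Finset.sum_congr rfl fun k hk => ?_
    have hk' : k ≤ n := Nat.lt_succ_iff.mp (Finset.mem_range.mp hk)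
    rw [show k + 1 + 1 + 1 = k + 3 by ring, Nat.cast_choose ℝ (by omega : k + 3 ≤ n + 3),
      show n + 3 - (k + 3) = n - k by omega, add_comm 3 k,
      show (n + 3).factorial = (n + 3) * ((n + 2) * ((n + 1) * n.factorial)) from rfl]
    push_cast
    field_simp
  rw [← key, Finset.sum_range_succ' _ (n + 3), Finset.sum_range_succ' _ (n + 2),
    Finset.sum_range_succ' _ (n + 1)]
  simp [c2]
  ring

lemma abs_rpow_taylor_le_sum {α y : ℝ} {n : ℕ} (hy : 0 ≤ y) (hn : α ≤ n + 3) :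
    |(1 + y) ^ α - 1 - α * y - α * (α - 1) / 2 * y ^ 2| ≤
      |α * (α - 1) * (α - 2)| * ∑ ℓ ∈ Finset.range (n + 1),
        (n.factorial : ℝ) / (((n - ℓ).factorial : ℝ) * ((3 + ℓ).factorial : ℝ)) * y ^ (ℓ + 3) := by
  set K := |α * (α - 1) * (α - 2)| with hK
  have hd (m : ℕ) (t : ℝ) : HasDerivAt (fun s : ℝ => (1 + s * y) ^ (m + 1))
      ((m + 1) * y * (1 + t * y) ^ m) t := by
    have h1 : HasDerivAt (fun s : ℝ => 1 + s * y) y t := by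
      simpa using ((hasDerivAt_id t).mul_const y).const_add 1
    refine (h1.pow (m + 1)).congr_deriv ?_
    simp
    ring
  rw [sum_factorial_mul_pow_eq]
  refine (abs_rpow_taylor_le (by linarith)
    (g₀ := fun t => K / ((n + 1) * (n + 2) * (n + 3)) * ((1 + t * y) ^ (n + 3) - 1 -
      (n + 3) * y * t - (n + 3) * (n + 2) / 2 * y ^ 2 * t ^ 2))
    (g₁ := fun t => K * y / ((n + 1) * (n + 2)) * ((1 + t * y) ^ (n + 2) - 1 - (n + 2) * y * t))
    (g₂ := fun t => K * y ^ 2 / (n + 1) * ((1 + t * y) ^ (n + 1) - 1))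
    (g₃ := fun t => K * y ^ 3 * (1 + t * y) ^ n)
    (fun t => ?_) (fun t => ?_) (fun t => ?_) (by simp) (by simp) (by simp)
    (fun t ht => ?_)).trans (le_of_eq ?_)
  · refine (((((hd (n + 2) t).sub_const 1).sub
      ((hasDerivAt_id' t).const_mul (((n : ℝ) + 3) * y))).sub
      ((hasDerivAt_pow 2 t).const_mul (((n : ℝ) + 3) * (n + 2) / 2 * y ^ 2))).const_mul
      (K / (((n : ℝ) + 1) * (n + 2) * (n + 3)))).congr_deriv ?_
    push_cast
    field_simp
    ring
  · refine ((((hd (n + 1) t).sub_const 1).sub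
      ((hasDerivAt_id' t).const_mul (((n : ℝ) + 2) * y))).const_mul
      (K * y / (((n : ℝ) + 1) * (n + 2)))).congr_deriv ?_
    push_cast
    field_simp
    ring
  · refine (((hd n t).sub_const 1).const_mul (K * y ^ 2 / ((n : ℝ) + 1))).congr_deriv ?_
    field_simp
  · rw [abs_of_nonneg hy]
    refine mul_le_mul_of_nonneg_left ?_ (by positivity)
    rw [← Real.rpow_natCast]
    exact Real.rpow_le_rpow_of_exponent_le (by nlinarith [mul_nonneg ht.1 hy]) (by linarith)
  · ring

lemma abs_one_add_mul_rpow_taylor_le {α q x : ℝ} (hq0 : 0 ≤ q) (hq1 : q < 1) (hx : -1 ≤ x)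
    (hα : 3 < α) {n : ℕ} (hn : α ≤ n + 3) :
    |(1 + q * x) ^ α - 1 - α * (q * x) - α * (α - 1) / 2 * (q * x) ^ 2| ≤
      q ^ 3 * |α * (α - 1) * (α - 2)| * (∑ ℓ ∈ Finset.range (n + 1),
        q ^ ℓ * (n.factorial : ℝ) / (((n - ℓ).factorial : ℝ) * ((3 + ℓ).factorial : ℝ)) *
          |x| ^ (ℓ + 3) + 1 / 6 * |x| ^ 3) := by
  have hsum : |α * (α - 1) * (α - 2)| * (∑ ℓ ∈ Finset.range (n + 1),
      (n.factorial : ℝ) / (((n - ℓ).factorial : ℝ) * ((3 + ℓ).factorial : ℝ)) *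
        |q * x| ^ (ℓ + 3) + 1 / 6 * |q * x| ^ 3) =
      q ^ 3 * |α * (α - 1) * (α - 2)| * (∑ ℓ ∈ Finset.range (n + 1),
        q ^ ℓ * (n.factorial : ℝ) / (((n - ℓ).factorial : ℝ) * ((3 + ℓ).factorial : ℝ)) *
          |x| ^ (ℓ + 3) + 1 / 6 * |x| ^ 3) := by
    have hs : ∑ ℓ ∈ Finset.range (n + 1),
        (n.factorial : ℝ) / (((n - ℓ).factorial : ℝ) * ((3 + ℓ).factorial : ℝ)) *
          |q * x| ^ (ℓ + 3) = q ^ 3 * ∑ ℓ ∈ Finset.range (n + 1),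
        q ^ ℓ * (n.factorial : ℝ) / (((n - ℓ).factorial : ℝ) * ((3 + ℓ).factorial : ℝ)) *
          |x| ^ (ℓ + 3) := by
      rw [Finset.mul_sum]
      refine Finset.sum_congr rfl fun ℓ _ => ?_
      rw [abs_mul, abs_of_nonneg hq0]
      ring
    rw [hs, abs_mul q, abs_of_nonneg hq0]
    ring
  rw [← hsum, mul_add]
  rcases le_total 0 x with h | h
  · have hy : 0 ≤ q * x := mul_nonneg hq0 h
    refine (abs_rpow_taylor_le_sum hy hn).trans ?_
    rw [abs_of_nonneg hy]
    exact le_add_of_nonneg_right (by positivity)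
  · refine (abs_rpow_taylor_le_of_le (C := 1) (by nlinarith) fun t ht => ?_).trans ?_
    · refine Real.rpow_le_one (one_add_mul_pos (by nlinarith) ht).le ?_ (by linarith)
      nlinarith [mul_nonneg ht.1 (mul_nonneg hq0 (neg_nonneg.2 h))]
    · rw [mul_one]
      exact le_add_of_nonneg_left (by positivity)

lemma abs_one_add_mul_rpow_taylor_le_of_le_three {α q x : ℝ} (hq0 : 0 ≤ q) (hq1 : q < 1)
    (hx : -1 ≤ x) (hα : α ≤ 3) :
    |(1 + q * x) ^ α - 1 - α * (q * x) - α * (α - 1) / 2 * (q * x) ^ 2| ≤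
      q ^ 3 * |α * (α - 1) * (α - 2)| * (1 / 6 * (1 - q) ^ (α - 3) * |x| ^ 3) := by
  refine (abs_rpow_taylor_le_of_le (C := (1 - q) ^ (α - 3)) (by nlinarith)
    fun t ht => ?_).trans (le_of_eq ?_)
  · refine Real.rpow_le_rpow_of_nonpos (by linarith) ?_ (by linarith)
    nlinarith [mul_nonneg ht.1 hq0, mul_nonneg (mul_nonneg ht.1 hq0) (by linarith : 0 ≤ x + 1),
      mul_nonneg hq0 (by linarith [ht.2] : 0 ≤ 1 - t)]
  · rw [abs_mul q, abs_of_nonneg hq0]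
    ring

section Moments

variable {Ω : Type*} [MeasurableSpace Ω] {ν : Measure Ω} {X : Ω → ℝ}

lemma integral_abs_pow_le_sqrt (hX : ∀ k : ℕ, Integrable (fun ω => X ω ^ k) ν) (a : ℕ) :
    ∫ ω, |X ω| ^ (2 * a + 1) ∂ν ≤
      Real.sqrt ((∫ ω, X ω ^ (2 * a) ∂ν) * ∫ ω, X ω ^ (2 * a + 2) ∂ν) := by
  have habs (k : ℕ) : Integrable (fun ω => |X ω| ^ k) ν := by
    simpa [abs_pow] using (hX k).abs
  have hd := discrim_le_zero (a := ∫ ω, X ω ^ (2 * a) ∂ν)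
    (b := -2 * ∫ ω, |X ω| ^ (2 * a + 1) ∂ν) (c := ∫ ω, X ω ^ (2 * a + 2) ∂ν) fun s => by
    have : 0 ≤ ∫ ω, (s * |X ω| ^ a - |X ω| ^ (a + 1)) ^ 2 ∂ν :=
      integral_nonneg fun _ => sq_nonneg _
    have hexp (ω : Ω) : (s * |X ω| ^ a - |X ω| ^ (a + 1)) ^ 2 =
        s * s * X ω ^ (2 * a) - 2 * s * |X ω| ^ (2 * a + 1) + X ω ^ (2 * a + 2) := by
      rw [← Even.pow_abs (even_two_mul a) (X ω),
        ← Even.pow_abs (show Even (2 * a + 2) from (even_two_mul a).add even_two) (X ω)]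
      ring
    simp_rw [hexp] at this
    rw [integral_add (by exact ((hX _).const_mul _).sub ((habs _).const_mul _)) (hX _),
      integral_sub ((hX _).const_mul _) ((habs _).const_mul _), integral_const_mul,
      integral_const_mul] at this
    linarith
  refine Real.le_sqrt_of_sq_le ?_
  rw [discrim] at hd
  linarith

lemma abs_integral_taylor_le [IsProbabilityMeasure ν] {F G : Ω → ℝ} {a b : ℝ}
    (hF : AEStronglyMeasurable F ν) (hG : Integrable G ν) (h₁ : Integrable X ν)
    (h₂ : Integrable (fun ω => X ω ^ 2) ν) (h0 : ∫ ω, X ω ∂ν = 0)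
    (hFG : ∀ ω, |F ω - 1 - a * X ω - b * X ω ^ 2| ≤ G ω) :
    |∫ ω, F ω ∂ν - 1 - b * ∫ ω, X ω ^ 2 ∂ν| ≤ ∫ ω, G ω ∂ν := by
  have hT : Integrable (fun ω => 1 + a * X ω + b * X ω ^ 2) ν :=
    ((integrable_const 1).add (h₁.const_mul a)).add (h₂.const_mul b)
  have hR : Integrable (fun ω => F ω - (1 + a * X ω + b * X ω ^ 2)) ν := by
    refine hG.mono' (hF.sub hT.aestronglyMeasurable) (.of_forall fun ω => ?_)
    simpa only [Real.norm_eq_abs, sub_sub, add_assoc] using hFG ω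
  have hFi : Integrable F ν := by
    refine (hR.add hT).congr (.of_forall fun ω => ?_)
    simp
  have hTi : ∫ ω, (1 + a * X ω + b * X ω ^ 2) ∂ν = 1 + b * ∫ ω, X ω ^ 2 ∂ν := by
    rw [integral_add (by exact (integrable_const 1).add (h₁.const_mul a)) (h₂.const_mul b),
      integral_add (integrable_const 1) (h₁.const_mul a), integral_const_mul, integral_const_mul,
      h0]
    simp
  rw [sub_sub, ← hTi, ← integral_sub hFi hT]
  refine (abs_integral_le_integral_abs).trans (integral_mono hR.abs hG fun ω => ?_)
  simpa only [sub_sub, add_assoc] using hFG ω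

end Moments

/-- The variance `s²` as a nonnegative real. -/
def sqVar (s : ℝ) : NNReal := ⟨s ^ 2, sq_nonneg s⟩

lemma gauss1_eq_gaussianPDFReal (μ s θ : ℝ) :
    gauss1 μ s θ = ProbabilityTheory.gaussianPDFReal μ (sqVar s) θ := by
  have h : 0 ≤ 2 * Real.pi * s ^ 2 := by positivity
  rw [gauss1, ProbabilityTheory.gaussianPDFReal, neg_div, Real.rpow_neg h, ← Real.sqrt_eq_rpow]
  rfl

lemma integral_mul_gauss1 {s : ℝ} (hs : s ≠ 0) (f : ℝ → ℝ) :
    ∫ θ, f θ * gauss1 0 s θ = ∫ θ, f θ ∂(ProbabilityTheory.gaussianReal 0 (sqVar s)) := by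
  have hv : sqVar s ≠ 0 := fun h => pow_ne_zero 2 hs (congrArg NNReal.toReal h)
  rw [ProbabilityTheory.integral_gaussianReal_eq_integral_smul hv]
  simp [gauss1_eq_gaussianPDFReal, mul_comm]

lemma gauss1_div_gauss1 {s : ℝ} (hs : s ≠ 0) (θ : ℝ) :
    gauss1 1 s θ / gauss1 0 s θ = Real.exp (-1 / (2 * s ^ 2)) * Real.exp (1 / s ^ 2 * θ) := by
  have h : (2 * Real.pi * s ^ 2) ^ (-(1 : ℝ) / 2) ≠ 0 :=
    (Real.rpow_pos_of_pos (by positivity) _).ne'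
  rw [gauss1, gauss1, mul_div_mul_left _ _ h, ← Real.exp_sub, ← Real.exp_add]
  congr 1
  field_simp
  ring

/-- The centred likelihood ratio `N_{1,s²} / N_{0,s²} - 1`. -/
def ratioSubOne (s θ : ℝ) : ℝ := gauss1 1 s θ / gauss1 0 s θ - 1

lemma neg_one_le_ratioSubOne {s : ℝ} (hs : s ≠ 0) (θ : ℝ) : -1 ≤ ratioSubOne s θ := by
  rw [ratioSubOne, gauss1_div_gauss1 hs]
  have : 0 < Real.exp (-1 / (2 * s ^ 2)) * Real.exp (1 / s ^ 2 * θ) := by positivity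
  linarith

lemma measurable_ratioSubOne {s : ℝ} (hs : s ≠ 0) : Measurable (ratioSubOne s) := by
  have : ratioSubOne s =
      fun θ => Real.exp (-1 / (2 * s ^ 2)) * Real.exp (1 / s ^ 2 * θ) - 1 :=
    funext fun θ => by rw [ratioSubOne, gauss1_div_gauss1 hs]
  rw [this]
  fun_prop

lemma integrable_ratioSubOne_pow {s : ℝ} (hs : s ≠ 0) (k : ℕ) :
    Integrable (fun θ => ratioSubOne s θ ^ k)
      (ProbabilityTheory.gaussianReal 0 (sqVar s)) := by
  simp only [ratioSubOne, gauss1_div_gauss1 hs, sub_eq_add_neg, add_pow]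
  refine integrable_finsetSum _ fun m _ => ?_
  have := ((ProbabilityTheory.integrable_exp_mul_gaussianReal (μ := 0) (v := sqVar s)
    (m * (1 / s ^ 2))).const_mul (Real.exp (-1 / (2 * s ^ 2)) ^ m)).mul_const
    ((-1) ^ (k - m) * (k.choose m : ℝ))
  refine this.congr (.of_forall fun θ => ?_)
  simp only [mul_pow, ← Real.exp_nat_mul]
  ring_nf

lemma integral_ratioSubOne {s : ℝ} (hs : s ≠ 0) :
    ∫ θ, ratioSubOne s θ ∂(ProbabilityTheory.gaussianReal 0 (sqVar s)) = 0 := by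
  have hm : ∫ θ, Real.exp (1 / s ^ 2 * θ) ∂(ProbabilityTheory.gaussianReal 0 (sqVar s)) =
      Real.exp (1 / (2 * s ^ 2)) := by
    have := congrFun (ProbabilityTheory.mgf_fun_id_gaussianReal (μ := 0) (v := sqVar s)) (1 / s ^ 2)
    rw [ProbabilityTheory.mgf] at this
    rw [this, show ((sqVar s : NNReal) : ℝ) = s ^ 2 from rfl]
    congr 1
    field_simp
    ring
  simp only [ratioSubOne, gauss1_div_gauss1 hs]
  rw [integral_sub ((ProbabilityTheory.integrable_exp_mul_gaussianReal _).const_mul _)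
    (integrable_const 1), integral_const_mul, hm, ← Real.exp_add]
  simp [neg_div]

lemma Mcoef_eq {σ : ℝ} (hσ : σ ≠ 0) (k : ℕ) :
    Mcoef σ k = ∫ θ, ratioSubOne (σ / 2) θ ^ k
      ∂(ProbabilityTheory.gaussianReal 0 (sqVar (σ / 2))) :=
  integral_mul_gauss1 (div_ne_zero hσ two_ne_zero) (fun θ => ratioSubOne (σ / 2) θ ^ k)

lemma Hfun_eq {σ : ℝ} (hσ : σ ≠ 0) (α q : ℝ) :
    Hfun α σ q = ∫ θ, (1 + q * ratioSubOne (σ / 2) θ) ^ α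
      ∂(ProbabilityTheory.gaussianReal 0 (sqVar (σ / 2))) := by
  rw [← integral_mul_gauss1 (div_ne_zero hσ two_ne_zero), Hfun]
  congr with θ
  rw [ratioSubOne]
  ring_nf

lemma integral_abs_pow_le_Btil {σ : ℝ} (hσ : σ ≠ 0) (j : ℕ) :
    ∫ θ, |ratioSubOne (σ / 2) θ| ^ j ∂(ProbabilityTheory.gaussianReal 0 (sqVar (σ / 2))) ≤
      Btil σ j := by
  rw [Btil]
  split_ifs with h
  · simp [Mcoef_eq hσ, h.pow_abs]
  · obtain ⟨a, rfl⟩ := Nat.not_even_iff_odd.mp h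
    simpa [Mcoef_eq hσ] using
      integral_abs_pow_le_sqrt (integrable_ratioSubOne_pow (div_ne_zero hσ two_ne_zero)) a

/-- Taylor expansion upper bound at order 3 for `H_{α,σ}`. -/
theorem stmt1 (α σ q : ℝ) (hα : 1 < α) (hσ : 0 < σ) (hq0 : 0 ≤ q) (hq1 : q < 1) :
    |Hfun α σ q - 1 - q ^ 2 / 2 * (α * (α - 1)) * Mcoef σ 2| ≤ Rtil3 α σ q := by
  have hs : σ / 2 ≠ 0 := by positivity
  set X := ratioSubOne (σ / 2)
  set ν := ProbabilityTheory.gaussianReal 0 (sqVar (σ / 2))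
  have hX : ∀ k : ℕ, Integrable (fun θ => X θ ^ k) ν := integrable_ratioSubOne_pow hs
  have habs (k : ℕ) : Integrable (fun θ => |X θ| ^ k) ν := by
    simpa [abs_pow] using (hX k).abs
  have hB (k : ℕ) : ∫ θ, |X θ| ^ k ∂ν ≤ Btil σ k := integral_abs_pow_le_Btil hσ.ne' k
  have hX1 : ∀ θ, -1 ≤ X θ := neg_one_le_ratioSubOne hs
  have hF : AEStronglyMeasurable (fun θ => (1 + q * X θ) ^ α) ν := by
    have := measurable_ratioSubOne hs
    exact Measurable.aestronglyMeasurable (by fun_prop)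
  have hc : q ^ 3 * α * (α - 1) * |α - 2| = q ^ 3 * |α * (α - 1) * (α - 2)| := by
    have : 0 ≤ α * (α - 1) := mul_nonneg (by linarith) (by linarith)
    rw [abs_mul (α * (α - 1)), abs_of_nonneg this]
    ring
  have hreduce {G : ℝ → ℝ} (hG : Integrable G ν)
      (hb : ∀ θ, |(1 + q * X θ) ^ α - 1 - α * (q * X θ) - α * (α - 1) / 2 * (q * X θ) ^ 2| ≤ G θ) :
      |Hfun α σ q - 1 - q ^ 2 / 2 * (α * (α - 1)) * Mcoef σ 2| ≤ ∫ θ, G θ ∂ν := by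
    rw [Hfun_eq hσ.ne', Mcoef_eq hσ.ne']
    refine abs_integral_taylor_le (a := α * q) hF hG (by simpa using hX 1) (hX 2)
      (integral_ratioSubOne hs) fun θ => ?_
    refine le_of_eq_of_le (congrArg abs ?_) (hb θ)
    ring
  rw [Rtil3]
  split_ifs with h3
  · set n := ⌈α⌉₊ - 3 with hn
    have hn' : α ≤ n + 3 := by
      have h4 : 3 ≤ ⌈α⌉₊ := by exact_mod_cast (h3.trans_le (Nat.le_ceil α)).le
      rw [hn, Nat.cast_sub h4]
      simpa using Nat.le_ceil α
    have hterm (ℓ : ℕ) : Integrable (fun θ => q ^ ℓ * (n.factorial : ℝ) /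
        (((n - ℓ).factorial : ℝ) * ((3 + ℓ).factorial : ℝ)) * |X θ| ^ (ℓ + 3)) ν :=
      (habs _).const_mul _
    have hsum := integrable_finsetSum (Finset.range (n + 1)) fun ℓ _ => hterm ℓ
    refine (hreduce ((hsum.add ((habs 3).const_mul (1 / 6))).const_mul _)
      fun θ => abs_one_add_mul_rpow_taylor_le hq0 hq1 (hX1 θ) h3 hn').trans ?_
    rw [integral_const_mul, integral_add' hsum ((habs 3).const_mul (1 / 6)),
      integral_finsetSum _ fun ℓ _ => hterm ℓ, integral_const_mul, hc]
    simp only [integral_const_mul]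
    gcongr <;> apply hB
  · refine (hreduce ((habs 3).const_mul _ |>.const_mul _)
      fun θ => abs_one_add_mul_rpow_taylor_le_of_le_three hq0 hq1 (hX1 θ) (not_lt.mp h3)).trans ?_
    rw [integral_const_mul, integral_const_mul, hc]
    have : 0 < (1 - q) ^ (α - 3) := Real.rpow_pos_of_pos (by linarith) _
    gcongr
    exact hB 3
end
end
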